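/- Let (R, m) be an n-dimensional Gorenstein local ring and I ⊂ R an ideal of height c. Then the endomorphism ring B = Hom_R(H^c_I(R), H^c_I(R)) is a commutative ring, and there is a natural isomorphism Hom_R(H^c_I(R), H^c_I(R)) ≅ Ext_R^c(H^c_I(R), R). -/

import Mathlib

open CategoryTheory CategoryTheory.Limits Opposite IsLocalRing

noncomputable section

universe u

/-- The `i`-th local cohomology of the `R`-module `M` with support in the ideal `J`,
defined (following Mathlib) as the direct limit of `Ext^i(R/J^α, M)`. -/
abbrev LC (R : Type u) [CommRing R] (J : Ideal R) (i : ℕ) (M : ModuleCat.{u} R) :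
    ModuleCat.{u} R :=
  (localCohomology J i).obj M

/-- `Ext^i_R(M, N)` as an `R`-module. -/
abbrev ExtM (R : Type u) [CommRing R] (i : ℕ) (M N : ModuleCat.{u} R) : ModuleCat.{u} R :=
  ((Ext R (ModuleCat.{u} R) i).obj (op M)).obj N

/-- The height of an ideal: the infimum of the heights of the primes containing it. -/
def idealHeight (R : Type u) [CommRing R] (I : Ideal R) : ℕ∞ :=
  ⨅ p : {p : PrimeSpectrum R // I ≤ p.asIdeal}, Order.height (p : PrimeSpectrum R)

/-- A Noetherian local ring `(R, 𝔪, k)` is Gorenstein if `Ext^i_R(k, R)` vanishes for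
`i ≠ dim R` and is isomorphic to `k` in degree `dim R`. -/
def IsGorensteinLocalRing (R : Type u) [CommRing R] [IsLocalRing R] : Prop :=
  IsNoetherianRing R ∧
    ∃ n : ℕ, ringKrullDim R = n ∧
      (∀ i : ℕ, i ≠ n →
        Subsingleton (ExtM R i (ModuleCat.of R (R ⧸ maximalIdeal R)) (ModuleCat.of R R))) ∧
      Nonempty ((ExtM R n (ModuleCat.of R (R ⧸ maximalIdeal R)) (ModuleCat.of R R)) ≃ₗ[R]
        (R ⧸ maximalIdeal R))

namespace ModuleExt

open CategoryTheory.Abelian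

variable {R : Type u} [CommRing R]
variable {A B C D : Type u} [AddCommGroup A] [Module R A] [AddCommGroup B] [Module R B]
  [AddCommGroup C] [Module R C] [AddCommGroup D] [Module R D]

/-- Precomposition with a linear map, as a map on `Ext`. -/
def pull (Y : ModuleCat.{u} R) (i : ℕ) (f : A →ₗ[R] B) :
    Abelian.Ext (ModuleCat.of R B) Y i →ₗ[R] Abelian.Ext (ModuleCat.of R A) Y i :=
  (Ext.mk₀ (ModuleCat.ofHom f)).precompOfLinear R Y (zero_add i)

variable {Y : ModuleCat.{u} R} {i : ℕ}

lemma pull_apply (f : A →ₗ[R] B) (x : Abelian.Ext (ModuleCat.of R B) Y i) :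
    pull Y i f x = (Ext.mk₀ (ModuleCat.ofHom f)).comp x (zero_add i) := rfl

lemma pull_comp (g : B →ₗ[R] C) (f : A →ₗ[R] B) (x : Abelian.Ext (ModuleCat.of R C) Y i) :
    pull Y i (g ∘ₗ f) x = pull Y i f (pull Y i g x) := by
  simp [pull_apply, ModuleCat.ofHom_comp]

lemma pull_id (x : Abelian.Ext (ModuleCat.of R A) Y i) : pull Y i LinearMap.id x = x := by
  simp [pull_apply]

lemma pull_add (f g : A →ₗ[R] B) : pull Y i (f + g) = pull Y i f + pull Y i g := by
  ext x
  have : ModuleCat.ofHom (f + g) = ModuleCat.ofHom f + ModuleCat.ofHom g := rfl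
  simp [pull_apply, this, Ext.mk₀_add, Ext.add_comp]

lemma pull_smul (r : R) (f : A →ₗ[R] B) : pull Y i (r • f) = r • pull Y i f := by
  ext x
  have : ModuleCat.ofHom (r • f) = r • ModuleCat.ofHom f := rfl
  simp [pull_apply, this, Ext.mk₀_smul]

lemma pull_zero : pull Y i (0 : A →ₗ[R] B) = 0 := by
  simpa using pull_smul (Y := Y) (i := i) (0 : R) (0 : A →ₗ[R] B)

lemma pull_smul_id (r : R) (x : Abelian.Ext (ModuleCat.of R A) Y i) :
    pull Y i (r • LinearMap.id) x = r • x := by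
  rw [pull_smul, LinearMap.smul_apply, pull_id]

/-- An element annihilating a module annihilates its `Ext` modules. -/
lemma smul_eq_zero_of_annihilates {r : R} (h : ∀ a : A, r • a = 0)
    (x : Abelian.Ext (ModuleCat.of R A) Y i) : r • x = 0 := by
  rw [← pull_smul_id, show (r • LinearMap.id : A →ₗ[R] A) = 0 by ext a; simp [h], pull_zero]
  rfl

lemma subsingleton_of_subsingleton [Subsingleton A] :
    Subsingleton (Abelian.Ext (ModuleCat.of R A) Y i) :=
  subsingleton_of_forall_eq 0 fun x => by
    simpa using smul_eq_zero_of_annihilates (r := (1 : R)) (fun a => Subsingleton.elim _ _) x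

section LongExactSequence

variable {f : A →ₗ[R] B} {g : B →ₗ[R] C} (hf : Function.Injective f)
  (hfg : Function.Exact f g) (hg : Function.Surjective g)

/-- The short complex of a pair of exact linear maps. -/
abbrev complexOfExact (hfg : Function.Exact f g) : ShortComplex (ModuleCat.{u} R) :=
  ShortComplex.mk (ModuleCat.ofHom f) (ModuleCat.ofHom g)
    (by ext x; exact hfg.apply_apply_eq_zero x)

include hf hg in
lemma shortExact_complexOfExact : (complexOfExact hfg).ShortExact where
  exact := (ShortComplex.ShortExact.moduleCat_exact_iff_function_exact _).mpr hfg
  mono_f := (ModuleCat.mono_iff_injective _).mpr hf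
  epi_g := (ModuleCat.epi_iff_surjective _).mpr hg

/-- The connecting homomorphism of the contravariant long exact sequence. -/
def connecting (Y : ModuleCat.{u} R) (i : ℕ) :
    Abelian.Ext (ModuleCat.of R A) Y i →ₗ[R] Abelian.Ext (ModuleCat.of R C) Y (i + 1) :=
  (shortExact_complexOfExact hf hfg hg).extClass.precompOfLinear R Y (add_comm 1 i)

include hf hfg hg in
lemma exact_pull_pull : Function.Exact (pull Y i g) (pull Y i f) := by
  intro x
  refine ⟨Ext.contravariant_sequence_exact₂ (shortExact_complexOfExact hf hfg hg) Y x, ?_⟩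
  rintro ⟨y, rfl⟩
  rw [← pull_comp, hfg.linearMap_comp_eq_zero, pull_zero]
  rfl

lemma exact_pull_connecting :
    Function.Exact (pull Y i f) (connecting hf hfg hg Y i) := by
  intro x
  refine ⟨Ext.contravariant_sequence_exact₁ (shortExact_complexOfExact hf hfg hg) Y x
    (add_comm 1 i), ?_⟩
  rintro ⟨y, rfl⟩
  exact (shortExact_complexOfExact hf hfg hg).extClass_comp_assoc y (h := add_comm 1 i)

lemma exact_connecting_pull :
    Function.Exact (connecting hf hfg hg Y i) (pull Y (i + 1) g) := by
  intro x
  refine ⟨fun h => Ext.contravariant_sequence_exact₃ (shortExact_complexOfExact hf hfg hg) Y x h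
    (add_comm 1 i), ?_⟩
  rintro ⟨y, rfl⟩
  exact (shortExact_complexOfExact hf hfg hg).comp_extClass_assoc y (add_comm 1 i)

include hf hfg hg in
lemma pull_injective_of_subsingleton
    (h : ∀ j, j + 1 = i → Subsingleton (Abelian.Ext (ModuleCat.of R A) Y j)) :
    Function.Injective (pull Y i g) := by
  cases i with
  | zero =>
    have : Epi (ModuleCat.ofHom g) := (ModuleCat.epi_iff_surjective _).mpr hg
    exact Ext.precomp_mk₀_injective_of_epi Y (ModuleCat.ofHom g)
  | succ j =>
    have := h j rfl
    rw [injective_iff_map_eq_zero]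
    intro x hx
    obtain ⟨y, rfl⟩ := (exact_connecting_pull hf hfg hg x).1 hx
    rw [Subsingleton.elim y 0, map_zero]

lemma connecting_naturality {A' B' C' : Type u} [AddCommGroup A'] [Module R A'] [AddCommGroup B']
    [Module R B'] [AddCommGroup C'] [Module R C'] {f' : A' →ₗ[R] B'} {g' : B' →ₗ[R] C'}
    (hf' : Function.Injective f') (hfg' : Function.Exact f' g') (hg' : Function.Surjective g')
    (a : A →ₗ[R] A') (b : B →ₗ[R] B') (c : C →ₗ[R] C') (hab : b ∘ₗ f = f' ∘ₗ a)
    (hbc : c ∘ₗ g = g' ∘ₗ b) (x : Abelian.Ext (ModuleCat.of R A') Y i) :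
    pull Y (i + 1) c (connecting hf' hfg' hg' Y i x) =
      connecting hf hfg hg Y i (pull Y i a x) := by
  let φ : complexOfExact hfg ⟶ complexOfExact hfg' :=
    { τ₁ := ModuleCat.ofHom a
      τ₂ := ModuleCat.ofHom b
      τ₃ := ModuleCat.ofHom c
      comm₁₂ := by ext t; exact (congrArg (fun h => h t) hab).symm
      comm₂₃ := by ext t; exact (congrArg (fun h => h t) hbc).symm }
  have h := ShortComplex.ShortExact.extClass_naturality (shortExact_complexOfExact hf hfg hg)
    (shortExact_complexOfExact hf' hfg' hg') φ
  have h1 : connecting hf hfg hg Y i (pull Y i a x) =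
      ((shortExact_complexOfExact hf hfg hg).extClass.comp (Ext.mk₀ φ.τ₁) (add_zero 1)).comp x
        (add_comm 1 i) :=
    (Ext.comp_assoc_of_second_deg_zero _ _ _ _).symm
  have h2 : pull Y (i + 1) c (connecting hf' hfg' hg' Y i x) =
      ((Ext.mk₀ φ.τ₃).comp (shortExact_complexOfExact hf' hfg' hg').extClass (zero_add 1)).comp x
        (add_comm 1 i) :=
    (Ext.comp_assoc _ _ _ (zero_add 1) (add_comm 1 i) (by lia)).symm
  rw [h1, h2, h]

end LongExactSequence

end ModuleExt

namespace ExtComparison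

open CategoryTheory.Abelian

variable {R : Type u} [CommRing R] {X X' : ModuleCat.{u} R} (P : ProjectiveResolution X)
  (P' : ProjectiveResolution X') (n : ℕ) (Y : ModuleCat.{u} R)

/-- The cocycles in degree `n` of the complex computing `Ext` by a projective resolution. -/
def cocycles : Submodule R (P.complex.X n ⟶ Y) where
  carrier := {f | P.complex.d (n + 1) n ≫ f = 0}
  add_mem' {f g} hf hg := by
    simp only [Set.mem_ofPred_eq] at hf hg ⊢
    rw [Preadditive.comp_add, hf, hg, add_zero]
  zero_mem' := by simp
  smul_mem' r f hf := by
    simp only [Set.mem_ofPred_eq] at hf ⊢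
    rw [Linear.comp_smul, hf, smul_zero]

variable {P n Y} in
lemma mem_cocycles_iff {f : P.complex.X n ⟶ Y} :
    f ∈ cocycles P n Y ↔ P.complex.d (n + 1) n ≫ f = 0 := Iff.rfl

variable {P Y} in
lemma eq_zero_of_extMk_eq_zero (f : P.complex.X 0 ⟶ Y) (hf : P.complex.d 1 0 ≫ f = 0)
    (h : P.extMk f 1 rfl hf = 0) : f = 0 := by
  rw [← P.extEquivCohomologyClass.apply_eq_iff_eq,
    ProjectiveResolution.extEquivCohomologyClass_extMk,
    ProjectiveResolution.extEquivCohomologyClass_zero,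
    CochainComplex.HomComplex.CohomologyClass.mk_eq_zero_iff,
    CochainComplex.HomComplex.Cocycle.toSingleMk_mem_coboundaries_iff _ _ _ _ _ 1
      (by simp)] at h
  obtain ⟨g, hg⟩ := h
  have hz : g = 0 := (CochainComplex.isZero_of_isStrictlyLE P.cochainComplex 0 1).eq_of_src _ _
  rw [hz, comp_zero] at hg
  rw [← cancel_epi (P.cochainComplexXIso (-(0 : ℕ)) 0 rfl).hom, ← hg, comp_zero]

/-- The map from cocycles to the `Ext` module defined through the derived category. -/
def toExt : cocycles P n Y →ₗ[R] Abelian.Ext X Y n where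
  toFun f := P.extMk f.1 (n + 1) rfl f.2
  map_add' f g := (P.add_extMk f.1 g.1 (n + 1) rfl f.2 g.2).symm
  map_smul' r f := by
    refine Eq.trans ?_ (Ext.smul_eq_comp_mk₀ (R := R) _ r).symm
    refine Eq.trans ?_ (P.extMk_comp_mk₀ f.1 (n + 1) rfl (mem_cocycles_iff.1 f.2) _).symm
    congr 1

lemma toExt_surjective : Function.Surjective (toExt P n Y) := fun x => by
  obtain ⟨f, hf, h⟩ := P.extMk_surjective x (n + 1) rfl
  exact ⟨⟨f, hf⟩, h⟩

lemma toExt_eq_zero_iff (f : cocycles P n Y) : toExt P n Y f = 0 ↔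
    ∃ g : P.complex.X ((ComplexShape.down ℕ).next n) ⟶ Y, P.complex.d n _ ≫ g = f.1 := by
  cases n with
  | zero =>
    constructor
    · intro h
      have : f.1 = 0 := eq_zero_of_extMk_eq_zero f.1 (mem_cocycles_iff.1 f.2) h
      exact ⟨0, by simp [this]⟩
    · rintro ⟨g, hg⟩
      have h : P.complex.d 0 ((ComplexShape.down ℕ).next 0) = 0 :=
        P.complex.shape _ _ (by simp [ChainComplex.next_nat_zero])
      have : f = 0 := Subtype.ext (by rw [← hg, h, zero_comp]; rfl)
      rw [this, map_zero]
  | succ p =>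
    rw [ChainComplex.next_nat_succ]
    exact P.extMk_eq_zero_iff f.1 (p + 2) rfl f.2 p rfl

/-- The complex of morphisms from the projective resolution `P` to `Y`. -/
abbrev homComplex : CochainComplex (ModuleCat.{u} R) ℕ := P.complex.linearYonedaObj R Y

/-- The inclusion of cocycles into the complex of morphisms. -/
def cocyclesι : ModuleCat.of R (cocycles P n Y) ⟶ (homComplex P Y).X n :=
  ModuleCat.ofHom (cocycles P n Y).subtype

lemma cocyclesι_d : cocyclesι P n Y ≫ (homComplex P Y).d n (n + 1) = 0 := by
  ext f
  exact f.2

/-- The map from cocycles to cohomology. -/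
def toHomology : ModuleCat.of R (cocycles P n Y) ⟶ (homComplex P Y).homology n :=
  (homComplex P Y).liftCycles (cocyclesι P n Y) (n + 1) (by simp) (cocyclesι_d P n Y) ≫
    (homComplex P Y).homologyπ n

lemma toHomology_surjective : Function.Surjective (toHomology P n Y) := by
  intro x
  have : Epi ((homComplex P Y).homologyπ n) := inferInstance
  obtain ⟨y, rfl⟩ := (ModuleCat.epi_iff_surjective _).1 this x
  have hy : (homComplex P Y).d n (n + 1) ((homComplex P Y).iCycles n y) = 0 := by
    rw [← ConcreteCategory.comp_apply, HomologicalComplex.iCycles_d]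
    rfl
  refine ⟨⟨(homComplex P Y).iCycles n y, hy⟩, ?_⟩
  rw [toHomology, ConcreteCategory.comp_apply]
  congr 1
  have : Mono ((homComplex P Y).iCycles n) := inferInstance
  apply (ModuleCat.mono_iff_injective _).1 this
  rw [← ConcreteCategory.comp_apply, HomologicalComplex.liftCycles_i]
  rfl

lemma toHomology_eq_zero_iff (f : cocycles P n Y) : toHomology P n Y f = 0 ↔
    ∃ g : P.complex.X ((ComplexShape.down ℕ).next n) ⟶ Y, P.complex.d n _ ≫ g = f.1 := by
  have hex := ShortComplex.exact_of_g_is_cokernel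
    (ShortComplex.mk _ _ ((homComplex P Y).toCycles_comp_homologyπ
      ((ComplexShape.down ℕ).next n) n)) ((homComplex P Y).homologyIsCokernel _ n rfl)
  rw [ShortComplex.ShortExact.moduleCat_exact_iff_function_exact] at hex
  have hm : Mono ((homComplex P Y).iCycles n) := inferInstance
  rw [ModuleCat.mono_iff_injective] at hm
  rw [toHomology, ConcreteCategory.comp_apply]
  refine (hex _).trans ?_
  constructor
  · rintro ⟨g, hg⟩
    refine ⟨g, ?_⟩
    have := congrArg ((homComplex P Y).iCycles n) hg
    dsimp only at this
    rw [← ConcreteCategory.comp_apply, ← ConcreteCategory.comp_apply,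
      HomologicalComplex.liftCycles_i, HomologicalComplex.toCycles_i] at this
    exact this
  · rintro ⟨g, hg⟩
    let g' : (homComplex P Y).X ((ComplexShape.down ℕ).next n) := g
    refine ⟨g', hm ?_⟩
    dsimp only
    rw [← ConcreteCategory.comp_apply, ← ConcreteCategory.comp_apply,
      HomologicalComplex.liftCycles_i, HomologicalComplex.toCycles_i]
    exact hg

/-- The map from cocycles to the `Ext` module defined through derived functors. -/
def toExtM : cocycles P n Y →ₗ[R] ExtM R n X Y :=
  (toHomology P n Y ≫ (P.isoExt n Y).inv).hom

lemma toExtM_surjective : Function.Surjective (toExtM P n Y) := by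
  have : Epi (P.isoExt (R := R) n Y).inv := inferInstance
  exact ((ModuleCat.epi_iff_surjective _).1 this).comp (toHomology_surjective P n Y)

lemma toExtM_eq_zero_iff (f : cocycles P n Y) :
    toExtM P n Y f = 0 ↔ toExt P n Y f = 0 := by
  rw [toExt_eq_zero_iff, ← toHomology_eq_zero_iff]
  have : Mono (P.isoExt (R := R) n Y).inv := inferInstance
  rw [ModuleCat.mono_iff_injective] at this
  exact map_eq_zero_iff (P.isoExt (R := R) n Y).inv.hom this

variable {P P'} in
/-- Functoriality of cocycles in the projective resolution. -/
def cocyclesMap {g : X' ⟶ X} (φ : ProjectiveResolution.Hom P' P g) :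
    cocycles P n Y →ₗ[R] cocycles P' n Y where
  toFun f := ⟨φ.hom.f n ≫ f.1, show _ ≫ _ ≫ _ = _ by
    rw [← φ.hom.comm_assoc, show _ ≫ f.1 = 0 from f.2, comp_zero]⟩
  map_add' f g := Subtype.ext (by simp)
  map_smul' r f := Subtype.ext (by simp)

variable {P P'} in
lemma toExt_naturality {g : X' ⟶ X} (φ : ProjectiveResolution.Hom P' P g) (f : cocycles P n Y) :
    toExt P' n Y (cocyclesMap n Y φ f) = (Ext.mk₀ g).comp (toExt P n Y f) (zero_add n) :=
  (ProjectiveResolution.mk₀_comp_extMk f.1 (n + 1) rfl f.2 φ).symm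

variable {P P'} in
/-- Functoriality of the complex of morphisms in the projective resolution. -/
def homComplexMap (φ : P'.complex ⟶ P.complex) : homComplex P Y ⟶ homComplex P' Y :=
  (HomologicalComplex.unopFunctor (ModuleCat.{u} R) _).map
    ((((linearYoneda R (ModuleCat.{u} R)).obj Y).rightOp.mapHomologicalComplex _).map φ).op

variable {P P'} in
lemma toHomology_naturality {g : X' ⟶ X} (φ : ProjectiveResolution.Hom P' P g)
    (f : cocycles P n Y) :
    toHomology P' n Y (cocyclesMap n Y φ f) =
      HomologicalComplex.homologyMap (homComplexMap Y φ.hom) n (toHomology P n Y f) := by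
  have : ModuleCat.ofHom (cocyclesMap n Y φ) ≫ toHomology P' n Y =
      toHomology P n Y ≫ HomologicalComplex.homologyMap (homComplexMap Y φ.hom) n := by
    rw [toHomology, toHomology, Category.assoc, HomologicalComplex.homologyπ_naturality,
      HomologicalComplex.liftCycles_comp_cyclesMap_assoc, ← Category.assoc,
      HomologicalComplex.comp_liftCycles]
    rfl
  exact ConcreteCategory.congr_hom this f

lemma homologyUnop_naturality {V ι : Type*} [Category* V] [Abelian V] {c : ComplexShape ι}
    {K L : HomologicalComplex Vᵒᵖ c} (φ : K ⟶ L) (i : ι) :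
    HomologicalComplex.homologyMap ((HomologicalComplex.unopFunctor V c).map φ.op) i ≫
      (K.homologyUnop i).hom =
    (L.homologyUnop i).hom ≫ (HomologicalComplex.homologyMap φ i).unop := by
  have h := HomologicalComplex.homologyOp_hom_naturality
    ((HomologicalComplex.unopFunctor V c).map φ.op) i
  exact (congrArg Quiver.Hom.unop h).symm

variable {P P'} in
lemma isoExt_inv_naturality {g : X' ⟶ X} (φ : ProjectiveResolution.Hom P' P g) :
    (P.isoExt (R := R) n Y).inv ≫
      (((Ext R (ModuleCat.{u} R) n).map g.op).app Y : ExtM R n X Y ⟶ ExtM R n X' Y) =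
    HomologicalComplex.homologyMap (homComplexMap Y φ.hom) n ≫ (P'.isoExt n Y).inv := by
  have h := congrArg Quiver.Hom.unop (ProjectiveResolution.isoLeftDerivedObj_hom_naturality g P' P
    φ.hom (by simpa using φ.hom_f_zero_comp_π_f_zero)
    ((linearYoneda R (ModuleCat.{u} R)).obj Y).rightOp n)
  have h2 := homologyUnop_naturality
    ((((linearYoneda R (ModuleCat.{u} R)).obj Y).rightOp.mapHomologicalComplex _).map φ.hom) n
  refine (Category.assoc _ _ _).trans ?_
  refine (congrArg (fun k => _ ≫ k) h).trans ?_
  refine Eq.trans ?_ (Category.assoc _ _ _)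
  exact (Category.assoc _ _ _).symm.trans (congrArg (fun k => k ≫ _) h2.symm)

variable {P P'} in
lemma toExtM_naturality {g : X' ⟶ X} (φ : ProjectiveResolution.Hom P' P g)
    (f : cocycles P n Y) :
    toExtM P' n Y (cocyclesMap n Y φ f) =
      ((Ext R (ModuleCat.{u} R) n).map g.op).app Y (toExtM P n Y f) := by
  have h := ConcreteCategory.congr_hom (isoExt_inv_naturality n Y φ) (toHomology P n Y f)
  refine Eq.trans ?_ h.symm
  refine (congrArg (P'.isoExt (R := R) n Y).inv (toHomology_naturality n Y φ f)).trans ?_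
  rfl

/-- The two definitions of `Ext` modules agree. -/
def comparison (n : ℕ) (X Y : ModuleCat.{u} R) : ExtM R n X Y ≃ₗ[R] Abelian.Ext X Y n :=
  let P := projectiveResolution X
  ((toExtM P n Y).quotKerEquivOfSurjective (toExtM_surjective P n Y)).symm ≪≫ₗ
    Submodule.quotEquivOfEq _ _ (by ext f; exact toExtM_eq_zero_iff P n Y f) ≪≫ₗ
    (toExt P n Y).quotKerEquivOfSurjective (toExt_surjective P n Y)

lemma comparison_toExtM (f : cocycles (projectiveResolution X) n Y) :
    comparison n X Y (toExtM _ n Y f) = toExt _ n Y f := by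
  have : ((toExtM (projectiveResolution X) n Y).quotKerEquivOfSurjective
      (toExtM_surjective _ n Y)).symm (toExtM _ n Y f) = Submodule.Quotient.mk f := by
    rw [LinearEquiv.symm_apply_eq]
    rfl
  simp only [comparison, LinearEquiv.trans_apply, this]
  rfl

lemma comparison_naturality (g : X' ⟶ X) (x : ExtM R n X Y) :
    comparison n X' Y (((Ext R (ModuleCat.{u} R) n).map g.op).app Y x) =
      (Ext.mk₀ g).comp (comparison n X Y x) (zero_add n) := by
  obtain ⟨f, rfl⟩ := toExtM_surjective (projectiveResolution X) n Y x
  let φ : ProjectiveResolution.Hom (projectiveResolution X') (projectiveResolution X) g :=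
    { hom := ProjectiveResolution.lift g _ _
      hom_f_zero_comp_π_f_zero := by
        have := congrArg (fun k => k.f 0)
          (ProjectiveResolution.lift_commutes g (projectiveResolution X') (projectiveResolution X))
        exact this }
  rw [← toExtM_naturality n Y φ, comparison_toExtM, comparison_toExtM, toExt_naturality]

end ExtComparison

namespace ModuleExt

open CategoryTheory.Abelian DirectSum

variable {R : Type u} [CommRing R] {Y : ModuleCat.{u} R}

lemma subsingleton_succ_of_projective {A : Type u} [AddCommGroup A] [Module R A]
    [Module.Projective R A] (i : ℕ) : Subsingleton (Abelian.Ext (ModuleCat.of R A) Y (i + 1)) :=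
  have : Projective (ModuleCat.of R A) := (IsProjective.iff_projective A).1 inferInstance
  subsingleton_of_forall_eq 0 fun x => x.eq_zero_of_projective

/-- The linear map `A →ₗ[R] Y` underlying an element of degree-zero `Ext`. -/
lemma exists_eq_mk₀ {A : Type u} [AddCommGroup A] [Module R A]
    (x : Abelian.Ext (ModuleCat.of R A) Y 0) :
    ∃ f : A →ₗ[R] Y, Ext.mk₀ (ModuleCat.ofHom f) = x := by
  obtain ⟨f, rfl⟩ := (Ext.mk₀_bijective _ _).2 x
  exact ⟨f.hom, rfl⟩

lemma pull_mk₀ {A B : Type u} [AddCommGroup A] [Module R A] [AddCommGroup B] [Module R B]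
    (f : A →ₗ[R] B) (g : B →ₗ[R] Y) :
    pull Y 0 f (Ext.mk₀ (ModuleCat.ofHom g)) = Ext.mk₀ (ModuleCat.ofHom (g ∘ₗ f)) := by
  rw [pull_apply, Ext.mk₀_comp_mk₀, ModuleCat.ofHom_comp]

lemma mk₀_ofHom_inj {A : Type u} [AddCommGroup A] [Module R A] {f g : A →ₗ[R] Y} :
    Ext.mk₀ (ModuleCat.ofHom f) = Ext.mk₀ (ModuleCat.ofHom g) ↔ f = g :=
  ⟨fun h => congrArg ModuleCat.Hom.hom ((Ext.mk₀_bijective _ _).1 h), fun h => by rw [h]⟩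

lemma exact_lmap {ι : Type u} {A B C : ι → Type u}
    [∀ j, AddCommGroup (A j)] [∀ j, Module R (A j)]
    [∀ j, AddCommGroup (B j)] [∀ j, Module R (B j)]
    [∀ j, AddCommGroup (C j)] [∀ j, Module R (C j)]
    {f : ∀ j, A j →ₗ[R] B j} {g : ∀ j, B j →ₗ[R] C j} (h : ∀ j, Function.Exact (f j) (g j)) :
    Function.Exact (DirectSum.lmap f) (DirectSum.lmap g) := by
  classical
  rw [LinearMap.exact_iff, DirectSum.ker_lmap, DirectSum.range_lmap]
  simp_rw [fun j => LinearMap.exact_iff.1 (h j)]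

variable (Y) in
/-- Restriction of an extension of a direct sum to the summands. -/
def restrict {ι : Type u} [DecidableEq ι] (i : ℕ) (X : ι → Type u)
    [∀ j, AddCommGroup (X j)] [∀ j, Module R (X j)] :
    Abelian.Ext (ModuleCat.of R (⨁ j, X j)) Y i →ₗ[R] ∀ j, Abelian.Ext (ModuleCat.of R (X j)) Y i :=
  LinearMap.pi fun j => pull Y i (DirectSum.lof R ι X j)

lemma restrict_apply {ι : Type u} [DecidableEq ι] (i : ℕ) (X : ι → Type u)
    [∀ j, AddCommGroup (X j)] [∀ j, Module R (X j)]
    (x : Abelian.Ext (ModuleCat.of R (⨁ j, X j)) Y i) (j : ι) :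
    restrict Y i X x j = pull Y i (DirectSum.lof R ι X j) x := rfl

section DimensionShift

variable {ι : Type u} [DecidableEq ι] {A B C : ι → Type u}
    [∀ j, AddCommGroup (A j)] [∀ j, Module R (A j)]
    [∀ j, AddCommGroup (B j)] [∀ j, Module R (B j)]
    [∀ j, AddCommGroup (C j)] [∀ j, Module R (C j)]
    {f : ∀ j, A j →ₗ[R] B j} {g : ∀ j, B j →ₗ[R] C j}

lemma lof_comp_eq_lmap_comp_lof (j : ι) : DirectSum.lof R ι B j ∘ₗ f j =
    DirectSum.lmap f ∘ₗ DirectSum.lof R ι A j :=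
  LinearMap.ext fun a => (DirectSum.lmap_lof f j a).symm

lemma bijective_restrict_succ [∀ j, Module.Projective R (B j)]
    (hf : ∀ j, Function.Injective (f j)) (hfg : ∀ j, Function.Exact (f j) (g j))
    (hg : ∀ j, Function.Surjective (g j)) {i : ℕ} (hA : Function.Bijective (restrict Y i A))
    (hB : Function.Surjective (restrict Y i B)) : Function.Bijective (restrict Y (i + 1) C) := by
  have hg' := (DirectSum.lmap_surjective g).2 hg
  have hf' := (DirectSum.lmap_injective f).2 hf
  have hfg' := exact_lmap hfg
  have hnat (j : ι) := connecting_naturality (Y := Y) (i := i) (hf j) (hfg j) (hg j)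
    hf' hfg' hg' _ _ _ (lof_comp_eq_lmap_comp_lof j) (lof_comp_eq_lmap_comp_lof j)
  constructor
  · refine (injective_iff_map_eq_zero _).2 fun x hx => ?_
    obtain ⟨y, rfl⟩ := (exact_connecting_pull hf' hfg' hg' x).1
      ((subsingleton_succ_of_projective i).elim _ _)
    have h1 (j : ι) : ∃ z, pull Y i (f j) z = pull Y i (DirectSum.lof R ι _ j) y := by
      refine (exact_pull_connecting (hf j) (hfg j) (hg j) _).1 ?_
      rw [← hnat j]
      exact congrFun hx j
    choose z hz using h1
    obtain ⟨z', rfl⟩ := hB z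
    have : pull Y i (DirectSum.lmap f) z' = y := by
      refine hA.1 (funext fun j => ?_)
      rw [restrict_apply, restrict_apply, ← hz, restrict_apply, ← pull_comp, ← pull_comp,
        lof_comp_eq_lmap_comp_lof]
    rw [← this, (exact_pull_connecting hf' hfg' hg').apply_apply_eq_zero]
  · intro x
    have h1 (j : ι) : ∃ y, connecting (hf j) (hfg j) (hg j) Y i y = x j :=
      (exact_connecting_pull (hf j) (hfg j) (hg j) (x j)).1
        ((subsingleton_succ_of_projective i).elim _ _)
    choose y hy using h1
    obtain ⟨y', rfl⟩ := hA.2 y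
    exact ⟨connecting hf' hfg' hg' Y i y', funext fun j => (hnat j y').trans (hy j)⟩

end DimensionShift

/-- `Ext` turns direct sums in the first variable into products. -/
lemma bijective_restrict (i : ℕ) : ∀ {ι : Type u} [DecidableEq ι] (X : ι → Type u)
    [∀ j, AddCommGroup (X j)] [∀ j, Module R (X j)], Function.Bijective (restrict Y i X) := by
  induction i with
  | zero =>
    intro ι _ X _ _
    constructor
    · intro x y hxy
      obtain ⟨f, rfl⟩ := exists_eq_mk₀ x
      obtain ⟨g, rfl⟩ := exists_eq_mk₀ y
      rw [mk₀_ofHom_inj]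
      refine DirectSum.linearMap_ext R fun j => ?_
      have := congrFun hxy j
      rwa [restrict_apply, restrict_apply, pull_mk₀, pull_mk₀, mk₀_ofHom_inj] at this
    · intro x
      choose f hf using fun j => exists_eq_mk₀ (x j)
      refine ⟨Ext.mk₀ (ModuleCat.ofHom (DirectSum.toModule R ι Y f)), ?_⟩
      funext j
      rw [restrict_apply, pull_mk₀, ← hf, mk₀_ofHom_inj]
      ext a
      simp
  | succ i ih =>
    intro ι _ X _ _
    exact bijective_restrict_succ
      (A := fun j => LinearMap.ker (Finsupp.linearCombination R (id : X j → X j)))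
      (fun j => Submodule.injective_subtype _) (fun j => LinearMap.exact_subtype_ker_map _)
      (fun j => Finsupp.linearCombination_id_surjective R (X j)) (ih _) (ih _).2

end ModuleExt

namespace ModuleExt

open CategoryTheory.Abelian DirectSum

variable {R : Type u} [CommRing R] (I : Ideal R) {Y : ModuleCat.{u} R}

section PowerTorsion

/-- A module is `I`-power torsion if each of its elements is killed by some power of `I`. -/
def IsPowerTorsion (N : Type u) [AddCommGroup N] [Module R N] : Prop :=
  ∀ x : N, ∃ α : ℕ, ∀ a ∈ I ^ α, a • x = 0

variable {N N' : Type u} [AddCommGroup N] [Module R N] [AddCommGroup N']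
  [Module R N']

variable {I}

/-- The linear map from a cyclic module determined by an element. -/
def fromCyclic {J : Ideal R} (x : N) (hx : ∀ a ∈ J, a • x = 0) : (R ⧸ J) →ₗ[R] N :=
  J.liftQ (LinearMap.toSpanSingleton R N x) fun a ha => hx a ha

lemma fromCyclic_mk {J : Ideal R} (x : N) (hx : ∀ a ∈ J, a • x = 0) (r : R) :
    fromCyclic x hx (Submodule.Quotient.mk r) = r • x := rfl

lemma fromCyclic_ext {J : Ideal R} {f g : (R ⧸ J) →ₗ[R] N}
    (h : f (Submodule.Quotient.mk 1) = g (Submodule.Quotient.mk 1)) : f = g := by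
  ext
  exact h

lemma comp_fromCyclic {J : Ideal R} (x : N) (hx : ∀ a ∈ J, a • x = 0) (f : N →ₗ[R] N')
    (hx' : ∀ a ∈ J, a • f x = 0) : f ∘ₗ fromCyclic x hx = fromCyclic (f x) hx' := by
  refine fromCyclic_ext ?_
  change f ((1 : R) • x) = (1 : R) • f x
  rw [map_smul]

lemma IsPowerTorsion.submodule (h : IsPowerTorsion I N) (K : Submodule R N) :
    IsPowerTorsion I K := fun x => by
  obtain ⟨α, hα⟩ := h x
  exact ⟨α, fun a ha => Subtype.ext (hα a ha)⟩

lemma isPowerTorsion_quotient (α : ℕ) : IsPowerTorsion I (R ⧸ I ^ α) := fun x =>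
  ⟨α, fun a ha => by
    obtain ⟨r, rfl⟩ := Submodule.Quotient.mk_surjective _ x
    rw [← Submodule.Quotient.mk_smul, Submodule.Quotient.mk_eq_zero]
    exact Ideal.mul_mem_right _ _ ha⟩

lemma exists_common_power (h : IsPowerTorsion I N) (x y : N) :
    ∃ α : ℕ, (∀ a ∈ I ^ α, a • x = 0) ∧ ∀ a ∈ I ^ α, a • y = 0 := by
  obtain ⟨α, hα⟩ := h x
  obtain ⟨β, hβ⟩ := h y
  exact ⟨max α β, fun a ha => hα a (Ideal.pow_le_pow_right (le_max_left _ _) ha),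
    fun a ha => hβ a (Ideal.pow_le_pow_right (le_max_right _ _) ha)⟩

lemma IsPowerTorsion.directSum {ι : Type u} {X : ι → Type u} [∀ j, AddCommGroup (X j)]
    [∀ j, Module R (X j)] (h : ∀ j, IsPowerTorsion I (X j)) : IsPowerTorsion I (⨁ j, X j) := by
  classical
  intro x
  induction x using DirectSum.induction_on with
  | zero => exact ⟨0, fun a _ => smul_zero a⟩
  | of j x =>
    obtain ⟨α, hα⟩ := h j x
    refine ⟨α, fun a ha => ?_⟩
    change a • DirectSum.lof R ι X j x = 0
    rw [← map_smul, hα a ha, map_zero]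
  | add x y hx hy =>
    obtain ⟨α, hα⟩ := hx
    obtain ⟨β, hβ⟩ := hy
    exact ⟨max α β, fun a ha => by
      rw [smul_add, hα a (Ideal.pow_le_pow_right (le_max_left _ _) ha),
        hβ a (Ideal.pow_le_pow_right (le_max_right _ _) ha), add_zero]⟩

/-- The direct sum of cyclic modules mapping onto `N`. -/
abbrev CyclicCover (α : N → ℕ) (I : Ideal R) : Type u := ⨁ x : N, R ⧸ I ^ α x

/-- The canonical map onto `N` from a direct sum of cyclic modules. -/
def cover [DecidableEq N] (α : N → ℕ) (h : ∀ x : N, ∀ a ∈ I ^ α x, a • x = 0) :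
    CyclicCover α I →ₗ[R] N :=
  DirectSum.toModule R N N fun x => fromCyclic x (h x)

lemma cover_comp_lof [DecidableEq N] (α : N → ℕ) (h : ∀ x : N, ∀ a ∈ I ^ α x, a • x = 0)
    (x : N) : cover α h ∘ₗ DirectSum.lof R N (fun x => R ⧸ I ^ α x) x = fromCyclic x (h x) := by
  ext
  simp [cover]

lemma cover_surjective [DecidableEq N] (α : N → ℕ) (h : ∀ x : N, ∀ a ∈ I ^ α x, a • x = 0) :
    Function.Surjective (cover α h) := fun x =>
  ⟨DirectSum.lof R N (fun x => R ⧸ I ^ α x) x (Submodule.Quotient.mk 1),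
    (LinearMap.congr_fun (cover_comp_lof α h x) _).trans (by rw [fromCyclic_mk, one_smul])⟩

omit [AddCommGroup N] [Module R N] in
lemma isPowerTorsion_cyclicCover (α : N → ℕ) : IsPowerTorsion I (CyclicCover α I) :=
  IsPowerTorsion.directSum fun x => isPowerTorsion_quotient (α x)

/-- Joint injectivity of restriction to cyclic modules. -/
lemma eq_zero_of_pull_fromCyclic {i : ℕ}
    (hK : ∀ (K : Type u) [AddCommGroup K] [Module R K], IsPowerTorsion I K →
      ∀ j, j + 1 = i → Subsingleton (Abelian.Ext (ModuleCat.of R K) Y j))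
    (ξ : Abelian.Ext (ModuleCat.of R N) Y i)
    (h : ∀ x : N, ∃ (α : ℕ) (hx : ∀ a ∈ I ^ α, a • x = 0), pull Y i (fromCyclic x hx) ξ = 0) :
    ξ = 0 := by
  classical
  choose α hα hξ using h
  have hinj := pull_injective_of_subsingleton (Y := Y) (i := i)
    (Submodule.injective_subtype (LinearMap.ker (cover α hα))) (LinearMap.exact_subtype_ker_map _)
    (cover_surjective α hα) (hK _ ((isPowerTorsion_cyclicCover α).submodule _))
  refine (map_eq_zero_iff _ hinj).1 ?_
  refine (map_eq_zero_iff _ (bijective_restrict i fun x : N => R ⧸ I ^ α x).1).1 ?_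
  funext x
  rw [restrict_apply, ← pull_comp, cover_comp_lof, hξ]
  rfl

lemma subsingleton_of_isPowerTorsion {c : ℕ}
    (hvan : ∀ i < c, ∀ α, Subsingleton (Abelian.Ext (ModuleCat.of R (R ⧸ I ^ α)) Y i)) (i : ℕ) :
    ∀ (N : Type u) [AddCommGroup N] [Module R N], IsPowerTorsion I N → i < c →
      Subsingleton (Abelian.Ext (ModuleCat.of R N) Y i) := by
  induction i with
  | zero =>
    intro N _ _ hN hc
    refine subsingleton_of_forall_eq 0 fun ξ => ?_
    refine eq_zero_of_pull_fromCyclic (I := I) (fun K _ _ hK j hj => by omega) ξ fun x => ?_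
    obtain ⟨α, hα⟩ := hN x
    exact ⟨α, hα, (hvan 0 hc α).elim _ _⟩
  | succ i ih =>
    intro N _ _ hN hc
    refine subsingleton_of_forall_eq 0 fun ξ => ?_
    refine eq_zero_of_pull_fromCyclic (I := I) (fun K _ _ hK j hj => ?_) ξ fun x => ?_
    · obtain rfl : j = i := by omega
      exact ih K hK (by omega)
    · obtain ⟨α, hα⟩ := hN x
      exact ⟨α, hα, (hvan _ hc α).elim _ _⟩

lemma eq_zero_of_pull_fromCyclic_of_le {c i : ℕ}
    (hvan : ∀ i < c, ∀ α, Subsingleton (Abelian.Ext (ModuleCat.of R (R ⧸ I ^ α)) Y i)) (hi : i ≤ c)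
    (ξ : Abelian.Ext (ModuleCat.of R N) Y i)
    (h : ∀ x : N, ∃ (α : ℕ) (hx : ∀ a ∈ I ^ α, a • x = 0), pull Y i (fromCyclic x hx) ξ = 0) :
    ξ = 0 :=
  eq_zero_of_pull_fromCyclic
    (fun K _ _ hK j hj => subsingleton_of_isPowerTorsion hvan j K hK (by omega)) ξ h

end PowerTorsion

variable {I} in
/-- The canonical map between quotients by powers of an ideal. -/
abbrev powFactor {α β : ℕ} (h : α ≤ β) : (R ⧸ I ^ β) →ₗ[R] (R ⧸ I ^ α) :=
  Submodule.factor (Ideal.pow_le_pow_right h)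

variable (Y) in
/-- A presentation of a module `H` as the direct limit of the modules `Ext^c(R/I^α, Y)`. -/
structure ExtColimit (c : ℕ) (H : Type u) [AddCommGroup H] [Module R H] where
  /-- The maps to the direct limit. -/
  ι (α : ℕ) : Abelian.Ext (ModuleCat.of R (R ⧸ I ^ α)) Y c →ₗ[R] H
  ι_pull {α β : ℕ} (h : α ≤ β) (x) : ι β (pull Y c (powFactor h) x) = ι α x
  exists_rep (h : H) : ∃ α x, ι α x = h
  eq_zero (α : ℕ) (x) (hx : ι α x = 0) : ∃ (β : ℕ) (h : α ≤ β), pull Y c (powFactor h) x = 0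

namespace ExtColimit

variable {I} {c : ℕ} {H : Type u} [AddCommGroup H] [Module R H] (L : ExtColimit I Y c H)
  (hvan : ∀ i < c, ∀ α, Subsingleton (Abelian.Ext (ModuleCat.of R (R ⧸ I ^ α)) Y i))

lemma smul_ext_eq_zero {α : ℕ} {i : ℕ} {a : R} (ha : a ∈ I ^ α)
    (x : Abelian.Ext (ModuleCat.of R (R ⧸ I ^ α)) Y i) : a • x = 0 :=
  smul_eq_zero_of_annihilates (fun y => by
    obtain ⟨r, rfl⟩ := Submodule.Quotient.mk_surjective _ y
    rw [← Submodule.Quotient.mk_smul, Submodule.Quotient.mk_eq_zero]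
    exact Ideal.mul_mem_right _ _ ha) x

include L in
lemma isPowerTorsion : IsPowerTorsion I H := fun h => by
  obtain ⟨α, x, rfl⟩ := L.exists_rep h
  exact ⟨α, fun a ha => by rw [← map_smul, smul_ext_eq_zero ha, map_zero]⟩

lemma powFactor_surjective {α β : ℕ} (h : α ≤ β) :
    Function.Surjective (powFactor (I := I) h) := Submodule.factor_surjective _

include hvan in
lemma pull_powFactor_injective {α β : ℕ} (h : α ≤ β) :
    Function.Injective (pull Y c (powFactor (I := I) h)) :=
  pull_injective_of_subsingleton
    (Submodule.injective_subtype (LinearMap.ker (powFactor (I := I) h)))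
    (LinearMap.exact_subtype_ker_map _) (powFactor_surjective h) fun j hj =>
    subsingleton_of_isPowerTorsion hvan j _ ((isPowerTorsion_quotient β).submodule _) (by omega)

include hvan in
lemma ι_injective (α : ℕ) : Function.Injective (L.ι α) := by
  refine (injective_iff_map_eq_zero _).2 fun x hx => ?_
  obtain ⟨β, h, hβ⟩ := L.eq_zero α x hx
  exact (map_eq_zero_iff _ (pull_powFactor_injective hvan h)).1 hβ

include hvan in
lemma mem_range_of_annihilated {α : ℕ} {h : H} (hh : ∀ a ∈ I ^ α, a • h = 0) :
    ∃ x, L.ι α x = h := by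
  obtain ⟨β₀, e₀, rfl⟩ := L.exists_rep h
  obtain ⟨β, hαβ, hβ⟩ : ∃ β, α ≤ β ∧ β₀ ≤ β := ⟨max α β₀, le_max_left _ _, le_max_right _ _⟩
  set e := pull Y c (powFactor (I := I) hβ) e₀ with he
  have hιe : L.ι β e = L.ι β₀ e₀ := L.ι_pull hβ e₀
  have hae (a : R) (ha : a ∈ I ^ α) : a • e = 0 := by
    apply L.ι_injective hvan β
    rw [map_smul, hιe, hh a ha, map_zero]
  have hK : pull Y c (LinearMap.ker (powFactor (I := I) hαβ)).subtype e = 0 := by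
    refine eq_zero_of_pull_fromCyclic_of_le hvan le_rfl _ fun x => ?_
    obtain ⟨⟨a⟩, hx⟩ := x
    have ha : a ∈ I ^ α := (Submodule.Quotient.mk_eq_zero _).1 hx
    have hxβ : ∀ b ∈ I ^ β, b • (⟨Submodule.Quotient.mk a, hx⟩ :
        LinearMap.ker (powFactor (I := I) hαβ)) = 0 := fun b hb =>
      Subtype.ext ((Submodule.Quotient.mk_eq_zero _).2 (Ideal.mul_mem_right _ _ hb))
    refine ⟨β, hxβ, ?_⟩
    have : (LinearMap.ker (powFactor (I := I) hαβ)).subtype ∘ₗ fromCyclic _ hxβ =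
        a • LinearMap.id := by
      refine fromCyclic_ext ?_
      change (1 : R) • (Submodule.Quotient.mk a : R ⧸ I ^ β) = a • Submodule.Quotient.mk 1
      rw [one_smul, ← Submodule.Quotient.mk_smul, smul_eq_mul, mul_one]
    refine (pull_comp _ _ _).symm.trans ?_
    refine Eq.trans (congrArg (fun k => pull Y c k e) this) ?_
    rw [pull_smul_id, hae a ha]
  obtain ⟨x, hx⟩ := (exact_pull_pull (Submodule.injective_subtype _)
    (LinearMap.exact_subtype_ker_map (powFactor (I := I) hαβ)) (powFactor_surjective hαβ) e).1 hK
  exact ⟨x, by rw [← L.ι_pull hαβ, hx, hιe]⟩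

section ToHom

variable {N N' : Type u} [AddCommGroup N] [Module R N] [AddCommGroup N'] [Module R N']

lemma ι_pull_fromCyclic_eq (ξ : Abelian.Ext (ModuleCat.of R N) Y c) (x : N) {α β : ℕ}
    (hα : ∀ a ∈ I ^ α, a • x = 0) (hβ : ∀ a ∈ I ^ β, a • x = 0) :
    L.ι α (pull Y c (fromCyclic x hα) ξ) = L.ι β (pull Y c (fromCyclic x hβ) ξ) := by
  have key {α β : ℕ} (h : α ≤ β) (hα : ∀ a ∈ I ^ α, a • x = 0) (hβ : ∀ a ∈ I ^ β, a • x = 0) :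
      L.ι α (pull Y c (fromCyclic x hα) ξ) = L.ι β (pull Y c (fromCyclic x hβ) ξ) := by
    have : fromCyclic x hα ∘ₗ powFactor h = fromCyclic x hβ := fromCyclic_ext rfl
    rw [← this, pull_comp, L.ι_pull]
  rcases le_total α β with h | h
  · exact key h hα hβ
  · exact (key h hβ hα).symm

/-- The value of the homomorphism associated with an extension class. -/
def toHomFun (hN : IsPowerTorsion I N) (ξ : Abelian.Ext (ModuleCat.of R N) Y c) (x : N) : H :=
  L.ι _ (pull Y c (fromCyclic x (hN x).choose_spec) ξ)

lemma toHomFun_eq (hN : IsPowerTorsion I N) (ξ : Abelian.Ext (ModuleCat.of R N) Y c) (x : N)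
    {α : ℕ} (hα : ∀ a ∈ I ^ α, a • x = 0) :
    L.toHomFun hN ξ x = L.ι α (pull Y c (fromCyclic x hα) ξ) :=
  L.ι_pull_fromCyclic_eq ξ x _ hα

/-- The natural map `Ext^c(N, Y) → Hom(N, H)` for an `I`-power torsion module `N`. -/
def toHom (hN : IsPowerTorsion I N) :
    Abelian.Ext (ModuleCat.of R N) Y c →ₗ[R] N →ₗ[R] H where
  toFun ξ :=
    { toFun := L.toHomFun hN ξ
      map_add' := fun x y => by
        obtain ⟨α, hx, hy⟩ := exists_common_power hN x y
        have hxy : ∀ a ∈ I ^ α, a • (x + y) = 0 := fun a ha => by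
          rw [smul_add, hx a ha, hy a ha, add_zero]
        have : fromCyclic (x + y) hxy = fromCyclic x hx + fromCyclic y hy :=
          fromCyclic_ext (smul_add _ _ _)
        rw [L.toHomFun_eq hN ξ _ hxy, L.toHomFun_eq hN ξ _ hx, L.toHomFun_eq hN ξ _ hy, this,
          pull_add, LinearMap.add_apply, map_add]
      map_smul' := fun r x => by
        obtain ⟨α, hx⟩ := hN x
        have hrx : ∀ a ∈ I ^ α, a • (r • x) = 0 := fun a ha => by
          rw [smul_comm, hx a ha, smul_zero]
        have : fromCyclic (r • x) hrx = r • fromCyclic x hx := fromCyclic_ext (smul_comm _ _ _)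
        rw [L.toHomFun_eq hN ξ _ hrx, L.toHomFun_eq hN ξ _ hx, this, pull_smul,
          LinearMap.smul_apply, map_smul]
        rfl }
  map_add' ξ ζ := by
    ext x
    simp [toHomFun]
  map_smul' r ξ := by
    ext x
    simp [toHomFun]

lemma toHom_apply (hN : IsPowerTorsion I N) (ξ : Abelian.Ext (ModuleCat.of R N) Y c) (x : N)
    {α : ℕ} (hα : ∀ a ∈ I ^ α, a • x = 0) :
    L.toHom hN ξ x = L.ι α (pull Y c (fromCyclic x hα) ξ) := L.toHomFun_eq hN ξ x hα

lemma toHom_pull (hN : IsPowerTorsion I N) (hN' : IsPowerTorsion I N') (f : N' →ₗ[R] N)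
    (ξ : Abelian.Ext (ModuleCat.of R N) Y c) :
    L.toHom hN' (pull Y c f ξ) = L.toHom hN ξ ∘ₗ f := by
  ext x
  obtain ⟨α, hx⟩ := hN' x
  have hfx : ∀ a ∈ I ^ α, a • f x = 0 := fun a ha => by rw [← map_smul, hx a ha, map_zero]
  rw [L.toHom_apply hN' _ x hx, LinearMap.comp_apply, L.toHom_apply hN _ _ hfx, ← pull_comp,
    comp_fromCyclic x hx f hfx]

include hvan in
lemma toHom_injective (hN : IsPowerTorsion I N) : Function.Injective (L.toHom hN) := by
  refine (injective_iff_map_eq_zero _).2 fun ξ hξ => ?_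
  refine eq_zero_of_pull_fromCyclic_of_le hvan le_rfl ξ fun x => ?_
  obtain ⟨α, hx⟩ := hN x
  refine ⟨α, hx, L.ι_injective hvan α ?_⟩
  rw [← L.toHom_apply hN, hξ, map_zero]
  rfl

include hvan in
lemma toHom_surjective (hN : IsPowerTorsion I N) : Function.Surjective (L.toHom hN) := by
  classical
  intro φ
  have hN' := hN
  choose α hα using hN'
  have h1 (x : N) : ∃ e, L.ι (α x) e = φ x := L.mem_range_of_annihilated hvan fun a ha => by
    rw [← map_smul, hα x a ha, map_zero]
  choose e he using h1
  obtain ⟨e', rfl⟩ := (bijective_restrict c fun x : N => R ⧸ I ^ α x).2 e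
  have hC := isPowerTorsion_cyclicCover (I := I) α
  have h2 : L.toHom hC e' = φ ∘ₗ cover α hα := by
    refine DirectSum.linearMap_ext R fun x => fromCyclic_ext ?_
    have hx : ∀ a ∈ I ^ α x, a • DirectSum.lof R N (fun x => R ⧸ I ^ α x) x
        (Submodule.Quotient.mk 1) = 0 := fun a ha => by
      rw [← map_smul, ← Submodule.Quotient.mk_smul, smul_eq_mul,
        (Submodule.Quotient.mk_eq_zero _).2 (Ideal.mul_mem_right _ _ ha), map_zero]
    have hl : fromCyclic _ hx = DirectSum.lof R N (fun x => R ⧸ I ^ α x) x :=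
      fromCyclic_ext (one_smul R (DirectSum.lof R N (fun x => R ⧸ I ^ α x) x
        (Submodule.Quotient.mk 1)))
    rw [LinearMap.comp_apply, L.toHom_apply hC _ _ hx, hl, ← restrict_apply, he,
      LinearMap.comp_assoc, cover_comp_lof, LinearMap.comp_apply, fromCyclic_mk, one_smul]
  have h3 : pull Y c (A := LinearMap.ker (cover α hα)) (B := CyclicCover α I)
      (LinearMap.ker (cover α hα)).subtype e' = 0 := by
    apply L.toHom_injective hvan (hC.submodule _)
    rw [L.toHom_pull hC, h2, map_zero, LinearMap.comp_assoc,
      (LinearMap.exact_subtype_ker_map (cover α hα)).linearMap_comp_eq_zero, LinearMap.comp_zero]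
  obtain ⟨ξ, hξ⟩ := (exact_pull_pull (Submodule.injective_subtype _)
    (LinearMap.exact_subtype_ker_map (cover α hα)) (cover_surjective α hα) e').1 h3
  refine ⟨ξ, LinearMap.ext fun x => ?_⟩
  obtain ⟨y, rfl⟩ := cover_surjective α hα x
  have := L.toHom_pull (fun x => ⟨α x, hα x⟩) hC (cover α hα) ξ
  rw [hξ, h2] at this
  exact (LinearMap.congr_fun this y).symm

/-- The isomorphism `Ext^c(N, Y) ≃ Hom(N, H)` for an `I`-power torsion module `N`. -/
def homEquiv (hN : IsPowerTorsion I N) :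
    Abelian.Ext (ModuleCat.of R N) Y c ≃ₗ[R] (N →ₗ[R] H) :=
  LinearEquiv.ofBijective (L.toHom hN) ⟨L.toHom_injective hvan hN, L.toHom_surjective hvan hN⟩

end ToHom

end ExtColimit

end ModuleExt

namespace LocalCohomologyColimit

open CategoryTheory.Abelian ModuleExt ExtComparison

variable {R : Type u} [CommRing R] (I : Ideal R) (c : ℕ) (Y : ModuleCat.{u} R)

/-- The directed system defining the local cohomology of `Y`. -/
abbrev system : (ℕᵒᵖ)ᵒᵖ ⥤ ModuleCat.{u} R :=
  localCohomology.diagram (localCohomology.idealPowersDiagram I) c ⋙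
    (evaluation (ModuleCat.{u} R) (ModuleCat.{u} R)).obj Y

/-- The structure maps to local cohomology. -/
def cocone : Cocone (system I c Y) :=
  ((evaluation (ModuleCat.{u} R) (ModuleCat.{u} R)).obj Y).mapCocone
    (colimit.cocone (localCohomology.diagram (localCohomology.idealPowersDiagram I) c))

/-- Local cohomology is the colimit of the defining system. -/
def isColimitCocone : IsColimit (cocone I c Y) :=
  isColimitOfPreserves ((evaluation (ModuleCat.{u} R) (ModuleCat.{u} R)).obj Y)
    (colimit.isColimit (localCohomology.diagram (localCohomology.idealPowersDiagram I) c))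

/-- The terms of the system are the modules `Ext^c(R/I^α, Y)`. -/
def termEquiv (α : ℕ) : (system I c Y).obj (op (op α)) ≃ₗ[R]
    Abelian.Ext (ModuleCat.of R (R ⧸ I ^ α)) Y c :=
  comparison c (ModuleCat.of R (R ⧸ I ^ α)) Y

lemma termEquiv_map {α β : ℕ} (h : α ≤ β) (x : (system I c Y).obj (op (op α))) :
    termEquiv I c Y β ((system I c Y).map (homOfLE h).op.op x) =
      pull Y c (powFactor h) (termEquiv I c Y α x) :=
  comparison_naturality c Y (ModuleCat.ofHom (powFactor (I := I) h)) x

instance : PreservesColimit (system I c Y) (forget (ModuleCat.{u} R)) :=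
  have := preservesFilteredColimitsOfSize_of_univLE.{u, u, 0, 0} (forget (ModuleCat.{u} R))
  have := PreservesFilteredColimitsOfSize.preserves_filtered_colimits
    (F := forget (ModuleCat.{u} R)) (ℕᵒᵖ)ᵒᵖ
  inferInstance

/-- Local cohomology as the direct limit of the modules `Ext^c(R/I^α, Y)`. -/
def extColimit : ExtColimit I Y c (LC R I c Y) where
  ι α := ((cocone I c Y).ι.app (op (op α))).hom ∘ₗ (termEquiv I c Y α).symm.toLinearMap
  ι_pull {α β} h x := by
    obtain ⟨x, rfl⟩ := (termEquiv I c Y α).surjective x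
    change (cocone I c Y).ι.app (op (op β)) ((termEquiv I c Y β).symm _) =
      (cocone I c Y).ι.app (op (op α)) ((termEquiv I c Y α).symm _)
    rw [← termEquiv_map, LinearEquiv.symm_apply_apply, LinearEquiv.symm_apply_apply,
      ← ModuleCat.comp_apply, (cocone I c Y).w]
  exists_rep h := by
    obtain ⟨j, x, hx⟩ := Concrete.isColimit_exists_rep _ (isColimitCocone I c Y) h
    refine ⟨j.unop.unop, termEquiv I c Y _ x, ?_⟩
    change (cocone I c Y).ι.app _ ((termEquiv I c Y _).symm _) = _
    rw [LinearEquiv.symm_apply_apply]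
    exact hx
  eq_zero α x hx := by
    obtain ⟨x, rfl⟩ := (termEquiv I c Y α).surjective x
    change (cocone I c Y).ι.app (op (op α)) ((termEquiv I c Y α).symm _) = 0 at hx
    rw [LinearEquiv.symm_apply_apply] at hx
    obtain ⟨k, f, g, hfg⟩ := Concrete.isColimit_exists_of_rep_eq _ (isColimitCocone I c Y) x
      (0 : (system I c Y).obj (op (op α))) (hx.trans (map_zero _).symm)
    have h : α ≤ k.unop.unop := f.unop.unop.le
    refine ⟨k.unop.unop, h, ?_⟩
    rw [← termEquiv_map]
    have hf : f = (homOfLE h).op.op := rfl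
    rw [← hf]
    refine (congrArg (termEquiv I c Y _) (hfg.trans (map_zero _))).trans (map_zero _)

end LocalCohomologyColimit

namespace ModuleExt

open CategoryTheory.Abelian

variable {R : Type u} [CommRing R]

/-- Noetherian induction on ideals along the filtration of a cyclic module by cyclic modules. -/
theorem ideal_induction [IsNoetherianRing R] {P : Ideal R → Prop} (top : P ⊤)
    (ext : ∀ (J K : Ideal R) (a : R), (∀ r, r ∈ K ↔ r * a ∈ J) → P K →
      P (J ⊔ Ideal.span {a}) → P J)
    (prime : ∀ q : Ideal R, q.IsPrime → (∀ J, q < J → P J) → P q) (J : Ideal R) : P J := by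
  induction J using WellFoundedGT.induction with
  | ind J ih =>
    by_cases hJ : J = ⊤
    · exact hJ ▸ top
    by_cases hp : J.IsPrime
    · exact prime J hp ih
    obtain ⟨a, ha, b, hb, hab⟩ := (Ideal.not_isPrime_iff.1 hp).resolve_left hJ
    have hK (r : R) : r ∈ J.colon {a} ↔ r * a ∈ J := by
      rw [Submodule.mem_colon_singleton, smul_eq_mul]
    refine ext J (J.colon {a}) a hK (ih _ ?_) (ih _ ?_)
    · refine lt_of_le_of_ne (fun r hr => (hK r).2 (J.mul_mem_right a hr)) fun h => hb ?_
      rw [h, hK, mul_comm]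
      exact hab
    · refine lt_of_le_of_ne le_sup_left fun h => ha ?_
      rw [h]
      exact Ideal.mem_sup_right (Ideal.mem_span_singleton_self a)

section Cyclic

variable {J K : Ideal R} {a : R} (h : ∀ r, r ∈ K ↔ r * a ∈ J)

/-- Multiplication by `a` as a map `R/(J : a) → R/J`. -/
def mulQuotient : (R ⧸ K) →ₗ[R] (R ⧸ J) :=
  fromCyclic (Submodule.Quotient.mk a) fun r hr => by
    rw [← Submodule.Quotient.mk_smul, Submodule.Quotient.mk_eq_zero]
    exact (h r).1 hr

lemma mulQuotient_mk (r : R) :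
    mulQuotient h (Submodule.Quotient.mk r) = Submodule.Quotient.mk (r * a) := rfl

lemma mulQuotient_injective : Function.Injective (mulQuotient h) := by
  refine (injective_iff_map_eq_zero _).2 fun x hx => ?_
  obtain ⟨r, rfl⟩ := Submodule.Quotient.mk_surjective _ x
  rw [mulQuotient_mk, Submodule.Quotient.mk_eq_zero] at hx
  exact (Submodule.Quotient.mk_eq_zero _).2 ((h r).2 hx)

variable (J a) in
/-- The projection `R/J → R/(J + (a))`. -/
abbrev cyclicProj : (R ⧸ J) →ₗ[R] (R ⧸ (J ⊔ Ideal.span {a})) :=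
  Submodule.factor le_sup_left

lemma exact_mulQuotient : Function.Exact (mulQuotient h) (cyclicProj J a) := by
  intro x
  obtain ⟨r, rfl⟩ := Submodule.Quotient.mk_surjective _ x
  refine ⟨fun hx => ?_, ?_⟩
  · obtain ⟨j, hj, s, hs, rfl⟩ := Submodule.mem_sup.1 ((Submodule.Quotient.mk_eq_zero _).1 hx)
    obtain ⟨t, rfl⟩ := Ideal.mem_span_singleton'.1 hs
    refine ⟨Submodule.Quotient.mk t, ?_⟩
    rw [mulQuotient_mk, Submodule.Quotient.mk_add, (Submodule.Quotient.mk_eq_zero _).2 hj, zero_add]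
  · rintro ⟨y, hy⟩
    obtain ⟨t, rfl⟩ := Submodule.Quotient.mk_surjective _ y
    rw [← hy, mulQuotient_mk]
    exact (Submodule.Quotient.mk_eq_zero _).2
      (Ideal.mem_sup_right (Ideal.mul_mem_left _ _ (Ideal.mem_span_singleton_self a)))

lemma cyclicProj_surjective : Function.Surjective (cyclicProj J a) :=
  Submodule.factor_surjective _

end Cyclic

variable (p : Ideal R) (Y : ModuleCat.{u} R)

/-- `Ext^i(R/J, Y)` is killed by an element outside the prime ideal `p`. -/
def LocallyNull (i : ℕ) (J : Ideal R) : Prop :=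
  ∃ s ∉ p, ∀ ξ : Abelian.Ext (ModuleCat.of R (R ⧸ J)) Y i, s • ξ = 0

variable {p Y}

lemma locallyNull_of_subsingleton [hp : p.IsPrime] {i : ℕ} {J : Ideal R}
    (h : Subsingleton (Abelian.Ext (ModuleCat.of R (R ⧸ J)) Y i)) : LocallyNull p Y i J :=
  ⟨1, (Ideal.ne_top_iff_one p).1 hp.ne_top, fun _ => h.elim _ _⟩

lemma LocallyNull.subsingleton [IsLocalRing R] {i : ℕ} {J : Ideal R}
    (h : LocallyNull (maximalIdeal R) Y i J) :
    Subsingleton (Abelian.Ext (ModuleCat.of R (R ⧸ J)) Y i) := by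
  obtain ⟨s, hs, h⟩ := h
  obtain ⟨u, rfl⟩ : IsUnit s := by simpa using hs
  refine subsingleton_of_forall_eq 0 fun ξ => ?_
  rw [← one_smul R ξ, ← u.inv_mul, mul_smul, h, smul_zero]

lemma locallyNull_top [hp : p.IsPrime] {i : ℕ} : LocallyNull p Y i ⊤ :=
  locallyNull_of_subsingleton subsingleton_of_subsingleton

lemma LocallyNull.extension [hp : p.IsPrime] {i : ℕ} {J K : Ideal R} {a : R}
    (h : ∀ r, r ∈ K ↔ r * a ∈ J) (hK : LocallyNull p Y i K)
    (hJ : LocallyNull p Y i (J ⊔ Ideal.span {a})) : LocallyNull p Y i J := by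
  obtain ⟨s, hs, hsK⟩ := hK
  obtain ⟨t, ht, htJ⟩ := hJ
  refine ⟨t * s, fun hts => (hp.mem_or_mem hts).elim ht hs, fun ξ => ?_⟩
  obtain ⟨ζ, hζ⟩ := (exact_pull_pull (Y := Y) (i := i) (mulQuotient_injective h)
    (exact_mulQuotient h) cyclicProj_surjective (s • ξ)).1 (by rw [map_smul, hsK])
  rw [mul_smul, ← hζ, ← map_smul, htJ, map_zero]

lemma locallyNull_of_subsingleton_of_succ {i : ℕ} {J K : Ideal R} {a : R}
    (h : ∀ r, r ∈ K ↔ r * a ∈ J)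
    (hJ : Subsingleton (Abelian.Ext (ModuleCat.of R (R ⧸ J)) Y i))
    (hJa : LocallyNull p Y (i + 1) (J ⊔ Ideal.span {a})) : LocallyNull p Y i K := by
  obtain ⟨s, hs, hsJ⟩ := hJa
  refine ⟨s, hs, fun ξ => ?_⟩
  obtain ⟨ζ, hζ⟩ := (exact_pull_connecting (Y := Y) (i := i) (mulQuotient_injective h)
    (exact_mulQuotient h) cyclicProj_surjective (s • ξ)).1 (by rw [map_smul, hsJ])
  rw [← hζ, hJ.elim ζ 0, map_zero]

lemma locallyNull_of_notMem {i : ℕ} {J : Ideal R} {s : R} (hsJ : s ∈ J) (hs : s ∉ p) :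
    LocallyNull p Y i J :=
  ⟨s, hs, fun ξ => smul_eq_zero_of_annihilates (fun x => by
    obtain ⟨r, rfl⟩ := Submodule.Quotient.mk_surjective _ x
    rw [← Submodule.Quotient.mk_smul, Submodule.Quotient.mk_eq_zero]
    exact J.mul_mem_right r hsJ) ξ⟩

open Polynomial in
lemma exists_notMem_smul_eq_zero [hp : p.IsPrime] {E : Type*} [AddCommGroup E] [Module R E]
    [Module.Finite R E] {s x : R} (hs : s ∉ p) (hx : x ∈ p) (h : ∀ e : E, ∃ e', s • e = x • e') :
    ∃ t ∉ p, ∀ e : E, t • e = 0 := by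
  obtain ⟨P, hP, -, hcoeff, haeval⟩ :=
    LinearMap.exists_monic_and_natDegree_eq_and_coeff_mem_pow_and_aeval_eq_zero R
      (algebraMap R (Module.End R E) s) (Ideal.span {x}) (by
        rintro _ ⟨e, rfl⟩
        obtain ⟨e', he'⟩ := h e
        rw [Module.algebraMap_end_apply, he']
        exact Submodule.smul_mem_smul (Ideal.mem_span_singleton_self x) trivial)
  refine ⟨P.eval s, fun hPs => hs ?_, fun e => ?_⟩
  · rw [hP.as_sum, eval_add, eval_pow, eval_X, eval_finsetSum] at hPs
    refine hp.mem_of_pow_mem P.natDegree ((Submodule.add_mem_iff_left _ ?_).1 hPs)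
    refine Submodule.sum_mem _ fun i hi => ?_
    rw [eval_mul, eval_C]
    refine p.mul_mem_right _ ?_
    refine (Ideal.span_singleton_le_iff_mem p).2 hx
      (Ideal.pow_le_self (Nat.sub_ne_zero_of_lt (Finset.mem_range.1 hi)) (hcoeff i))
  · rw [aeval_algebraMap_apply_eq_algebraMap_eval] at haeval
    rw [← Module.algebraMap_end_apply R R E, haeval, LinearMap.zero_apply]

lemma LocallyNull.of_succ [IsNoetherianRing R] [Module.Finite R Y] [hp : p.IsPrime] {i : ℕ}
    {q : Ideal R} (hq : q.IsPrime) {x : R} (hxq : x ∉ q) (hxp : x ∈ p)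
    (h : LocallyNull p Y (i + 1) (q ⊔ Ideal.span {x})) : LocallyNull p Y i q := by
  obtain ⟨s, hs, hsq⟩ := h
  have hK (r : R) : r ∈ q ↔ r * x ∈ q :=
    ⟨fun hr => q.mul_mem_right x hr, fun hr => (hq.mem_or_mem hr).resolve_right hxq⟩
  have hmul : mulQuotient hK = x • LinearMap.id := fromCyclic_ext (by
    rw [mulQuotient_mk, mul_comm]
    rfl)
  refine exists_notMem_smul_eq_zero hs hxp fun ξ => ?_
  obtain ⟨ζ, hζ⟩ := (exact_pull_connecting (Y := Y) (i := i) (mulQuotient_injective hK)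
    (exact_mulQuotient hK) cyclicProj_surjective (s • ξ)).1 (by rw [map_smul, hsq])
  refine ⟨ζ, ?_⟩
  rw [← hζ, hmul, pull_smul_id]

section Local

variable [IsLocalRing R] [IsNoetherianRing R] [Module.Finite R Y]

omit [IsNoetherianRing R] in
lemma exists_mem_maximalIdeal_notMem {q : Ideal R} (hq : q.IsPrime) (h : q ≠ maximalIdeal R) :
    ∃ x ∈ maximalIdeal R, x ∉ q :=
  SetLike.exists_of_lt (lt_of_le_of_ne (le_maximalIdeal hq.ne_top) h)

/-- Vanishing of `Ext^i(-, Y)` on cyclic modules for large `i`. -/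
theorem subsingleton_of_gt {n : ℕ}
    (hk : ∀ i > n, Subsingleton (Abelian.Ext (ModuleCat.of R (R ⧸ maximalIdeal R)) Y i))
    (J : Ideal R) : ∀ i > n, Subsingleton (Abelian.Ext (ModuleCat.of R (R ⧸ J)) Y i) := by
  suffices ∀ i > n, LocallyNull (maximalIdeal R) Y i J from fun i hi => (this i hi).subsingleton
  induction J using ideal_induction with
  | top => exact fun i _ => locallyNull_top
  | ext J K a h hK hJ => exact fun i hi => (hK i hi).extension h (hJ i hi)
  | prime q hq ih =>
    intro i hi
    by_cases hqm : q = maximalIdeal R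
    · subst hqm
      exact locallyNull_of_subsingleton (hk i hi)
    obtain ⟨x, hx, hxq⟩ := exists_mem_maximalIdeal_notMem hq hqm
    exact LocallyNull.of_succ hq hxq hx (ih _ (lt_of_le_of_ne le_sup_left fun h => hxq
      (h ▸ Ideal.mem_sup_right (Ideal.mem_span_singleton_self x))) _ (by omega))

/-- Vanishing of `Ext^i(R/J, Y)` for `i` less than the height of `J`. -/
theorem subsingleton_of_lt_height
    (hk : ∀ i : ℕ, (i : WithBot ℕ∞) < ringKrullDim R →
      Subsingleton (Abelian.Ext (ModuleCat.of R (R ⧸ maximalIdeal R)) Y i))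
    (J : Ideal R) : ∀ i : ℕ, (∀ q : Ideal R, q.IsPrime → J ≤ q → (i : ℕ∞) < q.height) →
      Subsingleton (Abelian.Ext (ModuleCat.of R (R ⧸ J)) Y i) := by
  suffices ∀ i : ℕ, (∀ q : Ideal R, q.IsPrime → J ≤ q → (i : ℕ∞) < q.height) →
    LocallyNull (maximalIdeal R) Y i J from fun i hi => (this i hi).subsingleton
  induction J using ideal_induction with
  | top => exact fun i _ => locallyNull_top
  | ext J K a h hK hJ =>
    exact fun i hi => (hK i fun q hq hKq => hi q hq
      (le_trans (fun r hr => (h r).2 (J.mul_mem_right a hr)) hKq)).extension h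
      (hJ i fun q hq hJq => hi q hq (le_sup_left.trans hJq))
  | prime q hq ih =>
    intro i hi
    have hiq := hi q hq le_rfl
    by_cases hqm : q = maximalIdeal R
    · subst hqm
      refine locallyNull_of_subsingleton (hk i ?_)
      rw [← maximalIdeal_height_eq_ringKrullDim]
      exact_mod_cast hiq
    obtain ⟨x, hx, hxq⟩ := exists_mem_maximalIdeal_notMem hq hqm
    have hlt : q < q ⊔ Ideal.span {x} := lt_of_le_of_ne le_sup_left fun h => hxq
      (h ▸ Ideal.mem_sup_right (Ideal.mem_span_singleton_self x))
    refine LocallyNull.of_succ hq hxq hx (ih _ hlt _ fun q' hq' hle => ?_)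
    refine lt_of_lt_of_le ?_ (Ideal.height_add_one_le_of_lt_of_isPrime (hlt.trans_le hle))
    rw [Nat.cast_add, Nat.cast_one]
    exact (ENat.add_lt_add_iff_right ENat.one_ne_top).2 hiq

/-- If `Ext^i(R/J, Y)` vanishes for `i > c` then, locally at each associated prime of `R/J`,
so does `Ext^i(-, Y)` on all cyclic modules. -/
theorem locallyNull_of_isAssociatedPrime {n c : ℕ}
    (hk : ∀ i > n, Subsingleton (Abelian.Ext (ModuleCat.of R (R ⧸ maximalIdeal R)) Y i))
    {J : Ideal R} (hJ : ∀ i > c, Subsingleton (Abelian.Ext (ModuleCat.of R (R ⧸ J)) Y i))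
    (hp : IsAssociatedPrime p (R ⧸ J)) {i : ℕ} (hi : c < i) (L : Ideal R) :
    LocallyNull p Y i L := by
  obtain ⟨hp, x, hx⟩ := isAssociatedPrime_iff.1 hp
  obtain ⟨b, rfl⟩ := Submodule.Quotient.mk_surjective _ x
  have hpb (r : R) : r ∈ p ↔ r * b ∈ J := by
    rw [hx, Submodule.mem_colon_singleton, ← Submodule.Quotient.mk_smul, Submodule.mem_bot,
      Submodule.Quotient.mk_eq_zero, smul_eq_mul]
  suffices ∀ k i, c < i → n < i + k → ∀ L, LocallyNull p Y i L from
    this (n + 1) i hi (by omega) L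
  intro k
  induction k with
  | zero => exact fun i _ hi L => locallyNull_of_subsingleton (subsingleton_of_gt hk L i hi)
  | succ k ih =>
    intro i hci hi L
    have ih := ih (i + 1) (by omega) (by omega)
    induction L using ideal_induction with
    | top => exact locallyNull_top
    | ext J K a h hK hJ => exact hK.extension h hJ
    | prime q hq _ =>
      by_cases hqp : q ≤ p
      · rcases eq_or_lt_of_le hqp with rfl | hlt
        · exact locallyNull_of_subsingleton_of_succ hpb (hJ i hci) (ih _)
        · obtain ⟨x, hx, hxq⟩ := SetLike.exists_of_lt hlt
          exact LocallyNull.of_succ hq hxq hx (ih _)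
      · obtain ⟨s, hsq, hsp⟩ := SetLike.not_le_iff_exists.1 hqp
        exact locallyNull_of_notMem hsq hsp

end Local

end ModuleExt

namespace ModuleExt

open CategoryTheory.Abelian RingTheory.Sequence

variable {R : Type u} [CommRing R]

section Rees

variable {N : Type u} [AddCommGroup N] [Module R N] {M : ModuleCat.{u} R} {r : R}

lemma comp_smulShortComplex_f_eq_zero (hr : ∀ x : N, r • x = 0) {i : ℕ}
    (x : Abelian.Ext (ModuleCat.of R N) (M.smulShortComplex r).X₁ i) :
    x.comp (Ext.mk₀ (M.smulShortComplex r).f) (add_zero i) = 0 := by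
  have key (x : Abelian.Ext (ModuleCat.of R N) M i) :
      x.comp (Ext.mk₀ (r • 𝟙 M)) (add_zero i) = 0 := by
    rw [Ext.mk₀_smul, Ext.comp_smul, Ext.comp_mk₀_id]
    exact smul_eq_zero_of_annihilates hr x
  exact (congrArg (fun f : M ⟶ M => Ext.comp (Y := M) x (Ext.mk₀ f) (add_zero i))
    (M.smulShortComplex_f_eq_smul_id r)).trans (key x)

lemma subsingleton_zero_of_isSMulRegular (hM : IsSMulRegular M r) (hr : ∀ x : N, r • x = 0) :
    Subsingleton (Abelian.Ext (ModuleCat.of R N) M 0) := by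
  refine subsingleton_of_forall_eq 0 fun x => ?_
  have := hM.smulShortComplex_shortExact.mono_f
  refine Ext.postcomp_mk₀_injective_of_mono (ModuleCat.of R N) (M.smulShortComplex r).f ?_
  exact (comp_smulShortComplex_f_eq_zero hr x).trans (map_zero _).symm

lemma extClass_comp_surjective (hM : IsSMulRegular M r) (hr : ∀ x : N, r • x = 0) (i : ℕ) :
    Function.Surjective fun x : Abelian.Ext (ModuleCat.of R N)
      (ModuleCat.of R (QuotSMulTop r M)) i =>
        x.comp hM.smulShortComplex_shortExact.extClass (rfl : i + 1 = i + 1) := fun x =>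
  Ext.covariant_sequence_exact₁ _ hM.smulShortComplex_shortExact x
    (comp_smulShortComplex_f_eq_zero hr x) rfl

lemma extClass_comp_injective (hM : IsSMulRegular M r) (i : ℕ)
    (h : Subsingleton (Abelian.Ext (ModuleCat.of R N) M i)) :
    Function.Injective fun x : Abelian.Ext (ModuleCat.of R N)
      (ModuleCat.of R (QuotSMulTop r M)) i =>
        x.comp hM.smulShortComplex_shortExact.extClass (rfl : i + 1 = i + 1) := by
  refine (injective_iff_map_eq_zero (hM.smulShortComplex_shortExact.extClass.postcomp
    (ModuleCat.of R N) (rfl : i + 1 = i + 1))).2 fun x hx => ?_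
  obtain ⟨y, rfl⟩ := Ext.covariant_sequence_exact₃ _ hM.smulShortComplex_shortExact x rfl hx
  have hy : y = 0 := h.elim _ _
  rw [hy, Ext.zero_comp]

/-- A weakly regular sequence on `M` gives a class in `Ext^c(M/(rs)M, M)` representing the functor
`Ext^c(-, M)` on modules killed by the sequence. -/
theorem exists_class_of_isWeaklyRegular (rs : List R) :
    ∀ M : ModuleCat.{u} R, IsWeaklyRegular M rs →
      ∀ (Q : Type u) [AddCommGroup Q] [Module R Q],
        (Q ≃ₗ[R] M ⧸ (Ideal.ofList rs • ⊤ : Submodule R M)) →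
      ∃ ε : Abelian.Ext (ModuleCat.of R Q) M rs.length,
        ∀ (N : Type u) [AddCommGroup N] [Module R N], (∀ r ∈ rs, ∀ x : N, r • x = 0) →
          (∀ i < rs.length, Subsingleton (Abelian.Ext (ModuleCat.of R N) M i)) ∧
          Function.Bijective fun f : N →ₗ[R] Q => pull M rs.length f ε := by
  induction rs with
  | nil =>
    intro M _ Q _ _ e
    have hbot : (Ideal.ofList ([] : List R) • ⊤ : Submodule R M) = ⊥ := by
      rw [Ideal.ofList_nil, Submodule.bot_smul]
    let e' : Q ≃ₗ[R] M := e.trans (Submodule.quotEquivOfEqBot _ hbot)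
    refine ⟨Ext.mk₀ (ModuleCat.ofHom e'.toLinearMap), fun N _ _ _ => ⟨fun i hi => by simp at hi, ?_⟩⟩
    have h1 : (fun f : N →ₗ[R] Q => pull M ([] : List R).length f
        (Ext.mk₀ (ModuleCat.ofHom e'.toLinearMap))) =
        fun f => Ext.mk₀ (ModuleCat.ofHom (e'.toLinearMap ∘ₗ f)) :=
      funext fun f => pull_mk₀ f e'.toLinearMap
    rw [h1]
    constructor
    · intro f g hfg
      have := congrArg ModuleCat.Hom.hom ((Ext.mk₀_bijective _ _).1 hfg)
      exact LinearMap.ext fun x => e'.injective (LinearMap.congr_fun this x)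
    · intro x
      obtain ⟨f, rfl⟩ := exists_eq_mk₀ x
      exact ⟨e'.symm.toLinearMap ∘ₗ f, congrArg _ (congrArg _ (LinearMap.ext fun x => by simp))⟩
  | cons r rs ih =>
    intro M hM Q _ _ e
    obtain ⟨hr, hrs⟩ := (isWeaklyRegular_cons_iff M r rs).1 hM
    obtain ⟨ε, hε⟩ := ih (ModuleCat.of R (QuotSMulTop r M)) hrs Q
      (e.trans (Submodule.quotOfListConsSMulTopEquivQuotSMulTopInner M r rs))
    refine ⟨ε.comp hr.smulShortComplex_shortExact.extClass rfl, fun N _ _ hN => ?_⟩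
    obtain ⟨h1, h2⟩ := hε N fun s hs => hN s (List.mem_cons_of_mem _ hs)
    have hrN : ∀ x : N, r • x = 0 := hN r List.mem_cons_self
    have h3 : ∀ i < (r :: rs).length, Subsingleton (Abelian.Ext (ModuleCat.of R N) M i) := by
      intro i hi
      cases i with
      | zero => exact subsingleton_zero_of_isSMulRegular hr hrN
      | succ i =>
        have := h1 i (by simpa using hi)
        exact (extClass_comp_surjective hr hrN i).subsingleton
    refine ⟨h3, ?_⟩
    have h4 : (fun f : N →ₗ[R] Q => pull M (r :: rs).length f
        (ε.comp hr.smulShortComplex_shortExact.extClass rfl)) =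
        (fun x : Abelian.Ext (ModuleCat.of R N) (ModuleCat.of R (QuotSMulTop r M)) rs.length =>
          x.comp hr.smulShortComplex_shortExact.extClass (rfl : rs.length + 1 = rs.length + 1)) ∘
        fun f : N →ₗ[R] Q => pull _ rs.length f ε := by
      funext f
      exact (Ext.comp_assoc _ _ _ (zero_add _) rfl (by simp)).symm
    rw [h4]
    exact Function.Bijective.comp ⟨extClass_comp_injective hr _ (h3 _ (by simp)),
      extClass_comp_surjective hr hrN _⟩ h2

end Rees

section Commute

variable {Y : ModuleCat.{u} R} {c : ℕ} {J p : Ideal R}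
  {ε : Abelian.Ext (ModuleCat.of R (R ⧸ J)) Y c}
  (hε : ∀ (N : Type u) [AddCommGroup N] [Module R N], (∀ r ∈ J, ∀ x : N, r • x = 0) →
    Function.Bijective fun f : N →ₗ[R] R ⧸ J => pull Y c f ε)
  {L : Type u} [AddCommGroup L] [Module R L] {j : L →ₗ[R] R ⧸ J} (hj : Function.Injective j)

include hε hj

/-- Locally at `p`, every map to `R/J` is proportional to a given embedding. -/
lemma exists_smul_eq_smul (hp : ∀ L : Ideal R, LocallyNull p Y (c + 1) L) (f : L →ₗ[R] R ⧸ J) :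
    ∃ s ∉ p, ∃ t : R, ∀ x, s • f x = t • j x := by
  have hJS (r : R) (hr : r ∈ J) (x : R ⧸ J) : r • x = 0 := by
    obtain ⟨a, rfl⟩ := Submodule.Quotient.mk_surjective _ x
    rw [← Submodule.Quotient.mk_smul, Submodule.Quotient.mk_eq_zero]
    exact J.mul_mem_right a hr
  have hJL (r : R) (hr : r ∈ J) (x : L) : r • x = 0 := hj (by rw [map_smul, hJS r hr, map_zero])
  let T : Ideal R := (LinearMap.range j).comap J.mkQ
  have hJT : J ≤ T := fun r hr => by
    change Submodule.Quotient.mk r ∈ LinearMap.range j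
    rw [(Submodule.Quotient.mk_eq_zero J).2 hr]
    exact zero_mem _
  have hexact : Function.Exact j (Submodule.factor hJT) := by
    intro x
    obtain ⟨r, rfl⟩ := Submodule.Quotient.mk_surjective _ x
    exact Submodule.Quotient.mk_eq_zero T
  obtain ⟨s, hs, hsT⟩ := hp T
  refine ⟨s, hs, ?_⟩
  obtain ⟨ζ, hζ⟩ := (exact_pull_connecting (Y := Y) (i := c) hj hexact
    (Submodule.factor_surjective hJT) (s • pull Y c f ε)).1 (by rw [map_smul, hsT])
  obtain ⟨g, rfl⟩ := (hε (R ⧸ J) hJS).2 ζ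
  obtain ⟨t, ht⟩ := Submodule.Quotient.mk_surjective _ (g (Submodule.Quotient.mk 1))
  have hg : g = t • LinearMap.id := fromCyclic_ext (by
    rw [← ht, LinearMap.smul_apply, LinearMap.id_apply, ← Submodule.Quotient.mk_smul, smul_eq_mul,
      mul_one])
  have key : s • f = t • j := (hε L hJL).1 (by
    change pull Y c (s • f) ε = pull Y c (t • j) ε
    rw [pull_smul, LinearMap.smul_apply, ← hζ]
    change pull Y c j (pull Y c g ε) = _
    rw [← pull_comp, hg]
    rfl)
  exact ⟨t, fun x => LinearMap.congr_fun key x⟩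

/-- The endomorphism ring of a submodule of `R/J` is commutative. -/
theorem commute_of_injective [IsNoetherianRing R]
    (hp : ∀ p : Ideal R, IsAssociatedPrime p (R ⧸ J) → ∀ L : Ideal R, LocallyNull p Y (c + 1) L)
    (φ ψ : Module.End R L) (x : L) : φ (ψ x) = ψ (φ x) := by
  by_contra hne
  have hd : j (φ (ψ x)) - j (ψ (φ x)) ≠ 0 := fun h => hne (hj (sub_eq_zero.1 h))
  obtain ⟨p, hpa, hpd⟩ := exists_le_isAssociatedPrime_of_isNoetherianRing R _ hd
  obtain ⟨s, hs, t, hst⟩ := exists_smul_eq_smul hε hj (hp p hpa) (j ∘ₗ φ)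
  obtain ⟨s', hs', t', hst'⟩ := exists_smul_eq_smul hε hj (hp p hpa) (j ∘ₗ ψ)
  have hmem : s * s' ∈ p := hpd (by
    rw [Submodule.mem_colon_singleton, Submodule.mem_bot, smul_sub, sub_eq_zero]
    have h1 : s • j (φ (ψ x)) = t • j (ψ x) := hst (ψ x)
    have h2 : s' • j (ψ (φ x)) = t' • j (φ x) := hst' (φ x)
    have h3 : s • j (φ x) = t • j x := hst x
    have h4 : s' • j (ψ x) = t' • j x := hst' x
    rw [mul_comm s s', mul_smul, h1, smul_comm s' t, h4, mul_comm s' s, mul_smul, h2,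
      smul_comm s t', h3, smul_comm])
  exact (hpa.1.mem_or_mem hmem).elim hs hs'

end Commute

end ModuleExt

namespace ModuleExt

open CategoryTheory.Abelian RingTheory.Sequence

variable {R : Type u} [CommRing R]

lemma subsingleton_quotient_of_isWeaklyRegular [IsLocalRing R] [IsNoetherianRing R] {rs : List R}
    (h : IsWeaklyRegular R rs) (mem : ∀ r ∈ rs, r ∈ maximalIdeal R) (Y : ModuleCat.{u} R) {i : ℕ}
    (hi : rs.length < i) :
    Subsingleton (Abelian.Ext (ModuleCat.of R (R ⧸ Ideal.ofList rs)) Y i) := by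
  have h1 := ModuleCat.projectiveDimension_quotient_eq_add_length_of_isWeaklyRegular
    (ModuleCat.of R R) rs h mem
  have hproj : projectiveDimension (ModuleCat.of R R) ≤ (0 : ℕ) :=
    (projectiveDimension_le_iff _ 0).2
      ((projective_iff_hasProjectiveDimensionLE_zero _).1 (ModuleCat.projective_of_free
        (Module.Free.chooseBasis R R)))
  have e : (ModuleCat.of R R ⧸ (Ideal.ofList rs • ⊤ : Submodule R R)) ≃ₗ[R] R ⧸ Ideal.ofList rs :=
    Submodule.quotEquivOfEq _ _ (by rw [smul_eq_mul, Ideal.mul_top])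
  have h2 : projectiveDimension (ModuleCat.of R (R ⧸ Ideal.ofList rs)) < i := by
    rw [← projectiveDimension_eq_of_iso e.toModuleIso, h1]
    refine (add_le_add_left hproj _).trans_lt ?_
    rw [Nat.cast_zero, zero_add]
    exact_mod_cast hi
  have := projectiveDimension_lt_iff.1 h2
  exact HasProjectiveDimensionLT.subsingleton _ i i le_rfl Y

lemma exists_isRegular_of_subsingleton [IsNoetherianRing R] {K : Ideal R} (hK : K ≠ ⊤) (c : ℕ)
    (h : ∀ i < c, Subsingleton (Abelian.Ext (ModuleCat.of R (R ⧸ K)) (ModuleCat.of R R) i)) :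
    ∃ rs : List R, rs.length = c ∧ (∀ r ∈ rs, r ∈ K) ∧ IsRegular R rs := by
  refine ModuleCat.exists_isRegular_of_exists_subsingleton_ext K c (ModuleCat.of R R) ?_
    (ModuleCat.of R (R ⧸ K)) ?_ h
  · rw [smul_eq_mul, Ideal.mul_top]
    exact hK.lt_top
  · rw [Module.support_eq_zeroLocus, Ideal.annihilator_quotient]

/-- For a class representing `Ext^c(-, Y)` on modules killed by `J`, the module `Ext^c(R/K, Y)`
with `J ≤ K` embeds into `R/J`. -/
lemma exists_injective_of_representing {Y : ModuleCat.{u} R} {c : ℕ} {J K : Ideal R}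
    {ε : Abelian.Ext (ModuleCat.of R (R ⧸ J)) Y c}
    (hε : Function.Bijective fun f : (R ⧸ K) →ₗ[R] R ⧸ J => pull Y c f ε) :
    ∃ j : Abelian.Ext (ModuleCat.of R (R ⧸ K)) Y c →ₗ[R] R ⧸ J, Function.Injective j := by
  let e : ((R ⧸ K) →ₗ[R] R ⧸ J) ≃ₗ[R] Abelian.Ext (ModuleCat.of R (R ⧸ K)) Y c :=
    LinearEquiv.ofBijective
      { toFun := fun f => pull Y c f ε
        map_add' := fun f g => by rw [pull_add, LinearMap.add_apply]
        map_smul' := fun a f => by rw [pull_smul, LinearMap.smul_apply, RingHom.id_apply] } hε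
  refine ⟨LinearMap.applyₗ (Submodule.Quotient.mk 1) ∘ₗ e.symm.toLinearMap, fun x y hxy => ?_⟩
  exact e.symm.injective (fromCyclic_ext hxy)

/-- If `Ext^i(R/I^α, R) = 0` for `i < c` and `R` has finite injective dimension, then the
endomorphisms of the direct limit of `Ext^c(R/I^α, R)` commute. -/
theorem end_commute [IsLocalRing R] [IsNoetherianRing R] {n c : ℕ} {I : Ideal R}
    {H : Type u} [AddCommGroup H] [Module R H] (hI : I ≠ ⊤)
    (hk : ∀ i > n, Subsingleton
      (Abelian.Ext (ModuleCat.of R (R ⧸ maximalIdeal R)) (ModuleCat.of R R) i))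
    (hvan : ∀ i < c, ∀ α, Subsingleton
      (Abelian.Ext (ModuleCat.of R (R ⧸ I ^ α)) (ModuleCat.of R R) i))
    (L : ExtColimit I (ModuleCat.of R R) c H) (f g : Module.End R H) (x : H) :
    f (g x) = g (f x) := by
  obtain ⟨α, hα⟩ := L.isPowerTorsion x
  have hIα : I ^ (α + 1) ≠ ⊤ := fun h => hI ((Ideal.pow_eq_top_iff).1 h |>.resolve_right (by simp))
  obtain ⟨rs, hlen, hrs, hreg⟩ := exists_isRegular_of_subsingleton hIα c fun i hi => hvan i hi _
  subst hlen
  have hmax (r : R) (hr : r ∈ rs) : r ∈ maximalIdeal R := le_maximalIdeal hIα (hrs r hr)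
  have hJ : Ideal.ofList rs ≤ I ^ (α + 1) := Ideal.span_le.2 hrs
  obtain ⟨ε, hε⟩ := exists_class_of_isWeaklyRegular rs (ModuleCat.of R R) hreg.toIsWeaklyRegular
    (R ⧸ Ideal.ofList rs)
    (Submodule.quotEquivOfEq _ _ (by rw [smul_eq_mul, Ideal.mul_top]))
  have hε' (N : Type u) [AddCommGroup N] [Module R N]
      (h : ∀ r ∈ Ideal.ofList rs, ∀ x : N, r • x = 0) :
      Function.Bijective fun f : N →ₗ[R] R ⧸ Ideal.ofList rs => pull (ModuleCat.of R R) _ f ε :=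
    (hε N fun r hr => h r (Ideal.subset_span hr)).2
  obtain ⟨j, hj⟩ := exists_injective_of_representing (hε' (R ⧸ I ^ (α + 1)) (fun r hr y => by
    obtain ⟨a, rfl⟩ := Submodule.Quotient.mk_surjective _ y
    rw [← Submodule.Quotient.mk_smul, Submodule.Quotient.mk_eq_zero]
    exact Ideal.mul_mem_right _ _ (hJ hr)))
  let T : Submodule R H := Submodule.torsionBySet R H (I ^ (α + 1) : Ideal R)
  have hT (y : H) : y ∈ T ↔ ∀ a ∈ I ^ (α + 1), a • y = 0 := by
    rw [Submodule.mem_torsionBySet_iff]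
    exact ⟨fun h a ha => h ⟨a, ha⟩, fun h a => h a a.2⟩
  have hrange : LinearMap.range (L.ι (α + 1)) = T := by
    ext y
    rw [hT]
    refine ⟨?_, fun h => L.mem_range_of_annihilated hvan h⟩
    rintro ⟨ξ, rfl⟩ a ha
    rw [← map_smul, ExtColimit.smul_ext_eq_zero ha, map_zero]
  have hmap (f : Module.End R H) (y : H) (hy : y ∈ T) : f y ∈ T :=
    (hT _).2 fun a ha => by rw [← map_smul, (hT y).1 hy a ha, map_zero]
  let e := (LinearEquiv.ofInjective _ (L.ι_injective hvan (α + 1))).trans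
    (LinearEquiv.ofEq _ _ hrange)
  have hx : x ∈ T := (hT x).2 fun a ha => hα a (Ideal.pow_le_pow_right (Nat.le_succ α) ha)
  exact congrArg Subtype.val (commute_of_injective hε' (j := j ∘ₗ e.symm.toLinearMap)
    (hj.comp e.symm.injective)
    (fun p hp => locallyNull_of_isAssociatedPrime hk (fun i hi =>
      subsingleton_quotient_of_isWeaklyRegular hreg.toIsWeaklyRegular hmax _ hi) hp
        (Nat.lt_succ_self _))
    (f.restrict (hmap f)) (g.restrict (hmap g)) ⟨x, hx⟩)

end ModuleExt

lemma idealHeight_le_height {R : Type u} [CommRing R] (I q : Ideal R) [hq : q.IsPrime] (h : I ≤ q) :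
    idealHeight R I ≤ q.height := by
  have := iInf_le (fun p : {p : PrimeSpectrum R // I ≤ p.asIdeal} =>
    Order.height (p : PrimeSpectrum R)) ⟨⟨q, hq⟩, h⟩
  rwa [← PrimeSpectrum.height_eq_orderHeight] at this

lemma idealHeight_top (R : Type u) [CommRing R] : idealHeight R ⊤ = ⊤ :=
  iInf_eq_top.2 fun p => (p.1.2.ne_top (top_le_iff.1 p.2)).elim

/-- Let `(R, 𝔪)` be an `n`-dimensional Gorenstein local ring and
`I ⊆ R` an ideal of height `c`.  Then the endomorphism ring
`B = Hom_R(H^c_I(R), H^c_I(R))` is commutative, and there is an isomorphism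
`Hom_R(H^c_I(R), H^c_I(R)) ≅ Ext^c_R(H^c_I(R), R)`. -/
theorem endo_ring_of_localCohomology_commutative_and_iso_ext
    (R : Type u) [CommRing R] [IsLocalRing R]
    (hGor : IsGorensteinLocalRing R) (n : ℕ) (hn : ringKrullDim R = n)
    (I : Ideal R) (c : ℕ) (hc : idealHeight R I = c) :
    (∀ f g : Module.End R ↥(LC R I c (ModuleCat.of R R)), f * g = g * f) ∧
    Nonempty ((Module.End R ↥(LC R I c (ModuleCat.of R R))) ≃ₗ[R]
      ↥(ExtM R c (LC R I c (ModuleCat.of R R)) (ModuleCat.of R R))) := by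
  obtain ⟨_, n', hn', hvanish, -⟩ := hGor
  have hk (i : ℕ) (hi : i ≠ n') : Subsingleton
      (Abelian.Ext (ModuleCat.of R (R ⧸ maximalIdeal R)) (ModuleCat.of R R) i) :=
    (ExtComparison.comparison i _ _).toEquiv.subsingleton_congr.1 (hvanish i hi)
  have hI : I ≠ ⊤ := by
    rintro rfl
    rw [idealHeight_top] at hc
    exact ENat.natCast_ne_top c hc.symm
  have hvan (i : ℕ) (hi : i < c) (α : ℕ) : Subsingleton
      (Abelian.Ext (ModuleCat.of R (R ⧸ I ^ α)) (ModuleCat.of R R) i) := by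
    refine ModuleExt.subsingleton_of_lt_height (fun i hi => hk i ?_) _ i fun q hq hq' => ?_
    · rintro rfl
      exact hi.ne hn'.symm
    · refine lt_of_lt_of_le ?_ (idealHeight_le_height I q (hq.le_of_pow_le hq'))
      rw [hc]
      exact_mod_cast hi
  let L := LocalCohomologyColimit.extColimit I c (ModuleCat.of R R)
  refine ⟨fun f g => LinearMap.ext fun x =>
    ModuleExt.end_commute hI (fun i hi => hk i (ne_of_gt hi)) hvan L f g x, ⟨?_⟩⟩
  exact (L.homEquiv hvan L.isPowerTorsion).symm ≪≫ₗ
    (ExtComparison.comparison c (LC R I c (ModuleCat.of R R)) (ModuleCat.of R R)).symm
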